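/- arXiv:1107.2719 — 3 statements merged into one kernel-verified Lean document; each statement's English description precedes it below -/
import Mathlib

section
/- Let k ≥ 2 and let (x_j), (y_j), (w_j), (z_j), for 2 ≤ j ≤ k, be non-negative integers such that x_j + y_j = w_j + z_j = j, x_j ≠ w_j, and x_j ≠ z_j for every 2 ≤ j ≤ k. Then there exists a finite set of integers A such that |x_j A − y_j A| > |w_j A − z_j A| for every 2 ≤ j ≤ k. In particular, for every k ≥ 1 there exists a finite set of integers A such that |cA + cA| > |cA − cA| for every 1 ≤ c ≤ k, i.e., a k-generational sum-dominant set exists. -/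
open Finset
open scoped Pointwise

/-- The `s`-fold sumset `sA = A + ⋯ + A` (`s` times), with `0A = {0}`. -/
def foldSum : ℕ → Finset ℤ → Finset ℤ
  | 0, _ => {0}
  | s + 1, A => A + foldSum s A

namespace GenSD

def gf {G : Type} [AddCommGroup G] [DecidableEq G] : ℕ → Finset G → Finset G
  | 0, _ => {0}
  | s + 1, A => A + gf s A

theorem foldSum_eq (s : ℕ) (A : Finset ℤ) : foldSum s A = gf s A := by
  induction s with
  | zero => rfl
  | succ n ih => simp [foldSum, gf, ih]

theorem gf_image {G H : Type} [AddCommGroup G] [DecidableEq G] [AddCommGroup H] [DecidableEq H]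
    (φ : G →+ H) (s : ℕ) (A : Finset G) : gf s (A.image φ) = (gf s A).image φ := by
  induction s with
  | zero => simp [gf]
  | succ n ih => simp only [gf, ih]; rw [Finset.image_add]

theorem gf_prod {G H : Type} [AddCommGroup G] [DecidableEq G] [AddCommGroup H] [DecidableEq H]
    (s : ℕ) (A : Finset G) (B : Finset H) : gf s (A ×ˢ B) = gf s A ×ˢ gf s B := by
  induction s with
  | zero => ext ⟨a, b⟩; simp [gf, Prod.ext_iff]
  | succ n ih => simp only [gf, ih]; rw [Finset.product_add_product_comm]

theorem gf_nonempty {G : Type} [AddCommGroup G] [DecidableEq G] (s : ℕ) (A : Finset G)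
    (h : A.Nonempty) : (gf s A).Nonempty := by
  induction s with
  | zero => simp [gf]
  | succ n ih => exact h.add ih

theorem gf_add (s t : ℕ) (A : Finset ℤ) : gf s A + gf t A = gf (s + t) A := by
  induction s with
  | zero => simp only [gf, Nat.zero_add]; exact zero_add (gf t A)
  | succ n ih => rw [Nat.succ_add]; simp only [gf]; rw [add_assoc, ih]

def f (A : Finset ℤ) (s d : ℕ) : ℕ := (gf s A - gf d A).card

theorem f_pos (A : Finset ℤ) (h : A.Nonempty) (s d : ℕ) : 0 < f A s d :=
  Finset.card_pos.2 ((gf_nonempty s A h).sub (gf_nonempty d A h))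

theorem transport (A : Finset (ℤ × ℤ)) (K : ℕ) : ∃ C : Finset ℤ, (A.Nonempty → C.Nonempty) ∧
    ∀ s d, s + d ≤ K → f C s d = (gf s A - gf d A).card := by
  classical
  let S : Finset (ℤ × ℤ) := ((range (K+1)) ×ˢ (range (K+1))).biUnion
    (fun p => gf p.1 A - gf p.2 A)
  let B : ℤ := ∑ p ∈ S, |p.1|
  have hB : ∀ p ∈ S, |p.1| ≤ B := fun p hp =>
    Finset.single_le_sum (f := fun p : ℤ × ℤ => |p.1|) (fun i _ => abs_nonneg _) hp
  let φ : ℤ × ℤ →+ ℤ := AddMonoidHom.mk' (fun p => p.1 + (2 * B + 1) * p.2) (by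
    intro a b; simp only [Prod.fst_add, Prod.snd_add]; ring)
  have hinj : Set.InjOn φ (S : Set (ℤ × ℤ)) := by
    rintro ⟨a, b⟩ h1 ⟨a', b'⟩ h2 h
    have e : a + (2 * B + 1) * b = a' + (2 * B + 1) * b' := h
    have q1 := abs_le.1 (hB _ h1)
    have q2 := abs_le.1 (hB _ h2)
    simp only at q1 q2
    have hbb : b = b' := by
      rcases lt_trichotomy b b' with hlt | heq | hgt
      · exfalso; nlinarith
      · exact heq
      · exfalso; nlinarith
    subst hbb
    have : a = a' := by linarith
    rw [this]
  refine ⟨A.image φ, fun h => h.image _, fun s d hsd => ?_⟩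
  unfold f
  have him : (gf s A).image φ - (gf d A).image φ = (gf s A - gf d A).image φ := by
    ext v
    simp only [Finset.mem_sub, Finset.mem_image]
    constructor
    · rintro ⟨_, ⟨a, ha, rfl⟩, _, ⟨b, hb, rfl⟩, rfl⟩
      exact ⟨a - b, ⟨a, ha, b, hb, rfl⟩, map_sub φ a b⟩
    · rintro ⟨_, ⟨a, ha, b, hb, rfl⟩, rfl⟩
      exact ⟨_, ⟨a, ha, rfl⟩, _, ⟨b, hb, rfl⟩, (map_sub φ a b).symm⟩
  rw [gf_image, gf_image, him]
  apply Finset.card_image_of_injOn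
  apply hinj.mono
  intro p hp
  simp only [S, Finset.coe_biUnion, Set.mem_iUnion]
  exact ⟨(s, d), by simp; omega, hp⟩

theorem prodLemma (A B : Finset ℤ) (hA : A.Nonempty) (hB : B.Nonempty) (K : ℕ) :
    ∃ C : Finset ℤ, C.Nonempty ∧ ∀ s d, s + d ≤ K → f C s d = f A s d * f B s d := by
  obtain ⟨C, h1, h2⟩ := transport (A ×ˢ B) K
  refine ⟨C, h1 (hA.product hB), fun s d h => ?_⟩
  rw [h2 s d h, gf_prod, gf_prod]
  unfold f
  rw [← Finset.card_product]
  congr 1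
  ext ⟨a, b⟩
  simp only [Finset.mem_sub, Finset.mem_product, Prod.ext_iff, Prod.exists, Prod.fst_sub,
    Prod.snd_sub]
  constructor
  · rintro ⟨p, q, ⟨hp, hq⟩, r, t, ⟨hr, ht⟩, e1, e2⟩
    exact ⟨⟨p, hp, r, hr, e1⟩, ⟨q, hq, t, ht, e2⟩⟩
  · rintro ⟨⟨p, hp, r, hr, e1⟩, ⟨q, hq, t, ht, e2⟩⟩
    exact ⟨p, q, ⟨hp, hq⟩, r, t, ⟨hr, ht⟩, e1, e2⟩

theorem powLemma (A B : Finset ℤ) (hA : A.Nonempty) (hB : B.Nonempty) (K n : ℕ) :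
    ∃ C : Finset ℤ, C.Nonempty ∧ ∀ s d, s + d ≤ K → f C s d = f A s d * f B s d ^ n := by
  induction n with
  | zero => exact ⟨A, hA, by simp⟩
  | succ n ih =>
    obtain ⟨C, hC, h⟩ := ih
    obtain ⟨D, hD, h'⟩ := prodLemma C B hC hB K
    exact ⟨D, hD, fun s d hs => by rw [h' s d hs, h s d hs]; ring⟩

/-- fringe structure -/
structure Fr (Q : ℤ) (X : Finset ℤ) (n : ℤ) (L R : Finset ℤ) : Prop where
  bd : ∀ v ∈ X, 0 ≤ v ∧ v ≤ n
  lo : ∀ v, 0 ≤ v → v < Q → (v ∈ X ↔ v ∈ L)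
  hi : ∀ v, 0 ≤ v → v < Q → (n - v ∈ X ↔ v ∈ R)
  mid : ∀ v, Q ≤ v → v ≤ n - Q → v ∈ X
  L0 : (0:ℤ) ∈ L
  R0 : (0:ℤ) ∈ R
  Ln : ∀ v ∈ L, 0 ≤ v
  Rn : ∀ v ∈ R, 0 ≤ v
  big : n = 0 ∨ 3 * Q ≤ n

theorem Fr.zero (Q : ℤ) (hQ : 0 < Q) : Fr Q {0} 0 {0} {0} := by
  refine ⟨?_, ?_, ?_, ?_, ?_, ?_, ?_, ?_, ?_⟩ <;> simp
  intros; omega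

theorem Fr.swap {Q : ℤ} {X : Finset ℤ} {n : ℤ} {L R : Finset ℤ} (h : Fr Q X n L R) :
    Fr Q (X.image (fun v => n - v)) n R L := by
  have key : ∀ v, v ∈ X.image (fun v => n - v) ↔ n - v ∈ X := by
    intro v
    simp only [Finset.mem_image]
    constructor
    · rintro ⟨a, ha, rfl⟩; simpa using ha
    · intro hv; exact ⟨_, hv, by ring⟩
  refine ⟨?_, ?_, ?_, ?_, h.R0, h.L0, h.Rn, h.Ln, h.big⟩
  · intro v hv; have := h.bd _ ((key v).1 hv); omega
  · intro v h1 h2; rw [key]; exact h.hi v h1 h2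
  · intro v h1 h2; rw [key]; simpa using h.lo v h1 h2
  · intro v h1 h2; rw [key]; apply h.mid <;> omega

theorem Fr.add {Q : ℤ} (hQ : 0 < Q) {X Y : Finset ℤ} {n n' : ℤ} {L R L' R' : Finset ℤ}
    (h : Fr Q X n L R) (h' : Fr Q Y n' L' R') : Fr Q (X + Y) (n + n') (L + L') (R + R') := by
  have x0 : (0:ℤ) ∈ X := (h.lo 0 le_rfl hQ).2 h.L0
  have y0 : (0:ℤ) ∈ Y := (h'.lo 0 le_rfl hQ).2 h'.L0
  have xn : n ∈ X := by simpa using (h.hi 0 le_rfl hQ).2 h.R0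
  refine ⟨?_, ?_, ?_, ?_, ?_, ?_, ?_, ?_, ?_⟩
  · intro v hv
    obtain ⟨a, ha, b, hb, rfl⟩ := Finset.mem_add.1 hv
    have := h.bd a ha; have := h'.bd b hb; omega
  · intro v h0 hv
    simp only [Finset.mem_add]
    constructor
    · rintro ⟨a, ha, b, hb, rfl⟩
      have q1 := h.bd a ha; have q2 := h'.bd b hb
      exact ⟨a, (h.lo a q1.1 (by omega)).1 ha, b, (h'.lo b q2.1 (by omega)).1 hb, rfl⟩
    · rintro ⟨a, ha, b, hb, rfl⟩
      have q1 := h.Ln a ha; have q2 := h'.Ln b hb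
      exact ⟨a, (h.lo a q1 (by omega)).2 ha, b, (h'.lo b q2 (by omega)).2 hb, rfl⟩
  · intro v h0 hv
    simp only [Finset.mem_add]
    constructor
    · rintro ⟨a, ha, b, hb, e⟩
      have q1 := h.bd a ha; have q2 := h'.bd b hb
      exact ⟨n - a, (h.hi (n - a) (by omega) (by omega)).1 (by simpa using ha), n' - b,
        (h'.hi (n' - b) (by omega) (by omega)).1 (by simpa using hb), by omega⟩
    · rintro ⟨a, ha, b, hb, rfl⟩
      have q1 := h.Rn a ha; have q2 := h'.Rn b hb
      exact ⟨n - a, (h.hi a q1 (by omega)).2 ha, n' - b, (h'.hi b q2 (by omega)).2 hb, by omega⟩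
  · intro v h1 h2
    rw [Finset.mem_add]
    rcases h'.big with e | e'
    · exact ⟨v, h.mid v h1 (by omega), 0, y0, by omega⟩
    rcases h.big with e | e
    · exact ⟨0, x0, v, h'.mid v h1 (by omega), by omega⟩
    by_cases c1 : v ≤ n - Q
    · exact ⟨v, h.mid v h1 c1, 0, y0, by omega⟩
    by_cases c2 : n + Q ≤ v
    · exact ⟨n, xn, v - n, h'.mid _ (by omega) (by omega), by omega⟩
    by_cases c3 : v ≤ n
    · exact ⟨v - Q, h.mid _ (by omega) (by omega), Q, h'.mid _ (by omega) (by omega), by omega⟩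
    · exact ⟨v - 2 * Q, h.mid _ (by omega) (by omega), 2 * Q, h'.mid _ (by omega) (by omega),
        by omega⟩
  · exact Finset.mem_add.2 ⟨0, h.L0, 0, h'.L0, by simp⟩
  · exact Finset.mem_add.2 ⟨0, h.R0, 0, h'.R0, by simp⟩
  · intro v hv
    obtain ⟨a, ha, b, hb, rfl⟩ := Finset.mem_add.1 hv
    have := h.Ln a ha; have := h'.Ln b hb; omega
  · intro v hv
    obtain ⟨a, ha, b, hb, rfl⟩ := Finset.mem_add.1 hv
    have := h.Rn a ha; have := h'.Rn b hb; omega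
  · have := h.big; have := h'.big; omega

theorem Fr.gf {Q : ℤ} (hQ : 0 < Q) {X : Finset ℤ} {n : ℤ} {L R : Finset ℤ} (h : Fr Q X n L R)
    (s : ℕ) : Fr Q (gf s X) (s * n) (gf s L) (gf s R) := by
  induction s with
  | zero => simpa [GenSD.gf] using Fr.zero Q hQ
  | succ k ih =>
    have := h.add hQ ih
    have e : ((k + 1 : ℕ) : ℤ) * n = n + k * n := by push_cast; ring
    rw [e]
    exact this

theorem Fr.card {Q : ℤ} (hQ : 0 < Q) {X : Finset ℤ} {n : ℤ} {L R : Finset ℤ} (h : Fr Q X n L R)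
    (hn : 3 * Q ≤ n) : X.card = (L.filter (· < Q)).card + (R.filter (· < Q)).card
      + (Finset.Icc Q (n - Q)).card := by
  have e : X = (L.filter (· < Q) ∪ (R.filter (· < Q)).image (fun v => n - v))
      ∪ Finset.Icc Q (n - Q) := by
    ext v
    simp only [Finset.mem_union, Finset.mem_filter, Finset.mem_image, Finset.mem_Icc]
    constructor
    · intro hv
      have b := h.bd v hv
      by_cases c1 : v < Q
      · exact Or.inl (Or.inl ⟨(h.lo v b.1 c1).1 hv, c1⟩)
      by_cases c2 : v ≤ n - Q
      · exact Or.inr ⟨by omega, c2⟩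
      · exact Or.inl (Or.inr ⟨n - v, ⟨(h.hi (n - v) (by omega) (by omega)).1 (by simpa using hv),
          by omega⟩, by omega⟩)
    · rintro ((⟨h1, h2⟩ | ⟨a, ⟨h1, h2⟩, rfl⟩) | ⟨h1, h2⟩)
      · exact (h.lo v (h.Ln v h1) h2).2 h1
      · exact (h.hi a (h.Rn a h1) h2).2 h1
      · exact h.mid v h1 h2
  rw [e, Finset.card_union_of_disjoint, Finset.card_union_of_disjoint,
    Finset.card_image_of_injective]
  · intro a b hab; simp only at hab; omega
  · rw [Finset.disjoint_left]
    intro v h1 h2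
    simp only [Finset.mem_filter, Finset.mem_image] at h1 h2
    obtain ⟨a, ha, rfl⟩ := h2
    omega
  · rw [Finset.disjoint_left]
    intro v h1 h2
    simp only [Finset.mem_union, Finset.mem_filter, Finset.mem_image, Finset.mem_Icc] at h1 h2
    rcases h1 with h1 | ⟨a, ha, rfl⟩ <;> omega

theorem gf_refl (n : ℤ) (A : Finset ℤ) (d : ℕ) :
    gf d (A.image (fun v => n - v)) = (gf d A).image (fun v => d * n - v) := by
  induction d with
  | zero => simp [gf]
  | succ k ih =>
    simp only [gf, ih]
    ext v
    simp only [Finset.mem_add, Finset.mem_image]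
    constructor
    · rintro ⟨_, ⟨a, ha, rfl⟩, _, ⟨b, hb, rfl⟩, rfl⟩
      exact ⟨a + b, ⟨a, ha, b, hb, rfl⟩, by push_cast; ring⟩
    · rintro ⟨_, ⟨a, ha, b, hb, rfl⟩, rfl⟩
      exact ⟨_, ⟨a, ha, rfl⟩, _, ⟨b, hb, rfl⟩, by push_cast; ring⟩

theorem Fr.f_eq {Q : ℤ} (hQ : 0 < Q) {A : Finset ℤ} {n : ℤ} {L R : Finset ℤ} (h : Fr Q A n L R)
    (hn : 3 * Q ≤ n) (s d : ℕ) (hsd : 1 ≤ s + d) :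
    f A s d = ((GenSD.gf s L + GenSD.gf d R).filter (· < Q)).card
      + ((GenSD.gf s R + GenSD.gf d L).filter (· < Q)).card
      + (Finset.Icc Q (((s + d : ℕ) : ℤ) * n - Q)).card := by
  have e : f A s d = (GenSD.gf s A + GenSD.gf d (A.image (fun v => n - v))).card := by
    rw [gf_refl]
    have : GenSD.gf s A + (GenSD.gf d A).image (fun v => d * n - v)
        = (GenSD.gf s A - GenSD.gf d A).image (fun v => d * n + v) := by
      ext v
      simp only [Finset.mem_add, Finset.mem_sub, Finset.mem_image]
      constructor
      · rintro ⟨a, ha, _, ⟨b, hb, rfl⟩, rfl⟩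
        exact ⟨a - b, ⟨a, ha, b, hb, rfl⟩, by ring⟩
      · rintro ⟨_, ⟨a, ha, b, hb, rfl⟩, rfl⟩
        exact ⟨a, ha, _, ⟨b, hb, rfl⟩, by ring⟩
    rw [this, Finset.card_image_of_injective _ (fun a b hab => by simpa using hab)]
    rfl
  have F := (h.gf hQ s).add hQ (h.swap.gf hQ d)
  have e2 : (s:ℤ) * n + d * n = ((s + d : ℕ) : ℤ) * n := by push_cast; ring
  rw [e2] at F
  rw [e, F.card hQ]
  have : (1:ℤ) ≤ ((s + d : ℕ) : ℤ) := by exact_mod_cast hsd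
  nlinarith

def box (N p q : ℕ) : Finset ℤ :=
  ((range (p + 1)) ×ˢ (range (q + 1))).image (fun u => ((u.1 + N * u.2 : ℕ) : ℤ))

theorem mem_box {N p q : ℕ} {v : ℤ} :
    v ∈ box N p q ↔ ∃ a b : ℕ, a ≤ p ∧ b ≤ q ∧ v = ((a + N * b : ℕ) : ℤ) := by
  simp only [box, Finset.mem_image, Finset.mem_product, Finset.mem_range, Prod.exists]
  constructor
  · rintro ⟨a, b, ⟨h1, h2⟩, rfl⟩; exact ⟨a, b, by omega, by omega, rfl⟩
  · rintro ⟨a, b, h1, h2, rfl⟩; exact ⟨a, b, ⟨by omega, by omega⟩, rfl⟩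

theorem box_add (N p q p' q' : ℕ) : box N p q + box N p' q' = box N (p + p') (q + q') := by
  ext v
  simp only [Finset.mem_add, mem_box]
  constructor
  · rintro ⟨_, ⟨a, b, h1, h2, rfl⟩, _, ⟨c, d, h3, h4, rfl⟩, rfl⟩
    exact ⟨a + c, b + d, by omega, by omega, by push_cast; ring⟩
  · rintro ⟨a, b, h1, h2, rfl⟩
    refine ⟨_, ⟨min a p, min b q, by omega, by omega, rfl⟩, _,
      ⟨a - min a p, b - min b q, by omega, by omega, rfl⟩, ?_⟩
    have e1 : a = min a p + (a - min a p) := by omega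
    have e2 : b = min b q + (b - min b q) := by omega
    generalize a - min a p = a1 at *
    generalize b - min b q = b1 at *
    generalize min a p = a2 at *
    generalize min b q = b2 at *
    subst e1 e2
    push_cast; ring

theorem gf_box (N p q s : ℕ) : gf s (box N p q) = box N (s * p) (s * q) := by
  induction s with
  | zero => simp [gf, box]
  | succ k ih => simp only [gf, ih, box_add]; congr 1 <;> ring

theorem box_lt {N p q : ℕ} (hp : p < N) (hq : q < N) : ∀ v ∈ box N p q, 0 ≤ v ∧ v < (N:ℤ) * N := by
  intro v hv
  obtain ⟨a, b, h1, h2, rfl⟩ := mem_box.1 hv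
  refine ⟨by positivity, ?_⟩
  have : a + N * b < N * N := by nlinarith
  exact_mod_cast this

theorem box_card_small {N p q : ℕ} (hp : p < N) (hq : q < N) :
    ((box N p q).filter (· < (N:ℤ) * N)).card = (p + 1) * (q + 1) := by
  rw [Finset.filter_true_of_mem (fun v hv => (box_lt hp hq v hv).2), box,
    Finset.card_image_of_injOn]
  · simp
  · rintro ⟨a, b⟩ h1 ⟨c, d⟩ h2 e
    simp at h1 h2
    have e' : a + N * b = c + N * d := Nat.cast_injective (R := ℤ) e
    have ha : (a + N * b) % N = a := by rw [Nat.add_mul_mod_self_left]; exact Nat.mod_eq_of_lt (by omega)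
    have hc : (c + N * d) % N = c := by rw [Nat.add_mul_mod_self_left]; exact Nat.mod_eq_of_lt (by omega)
    have : a = c := by rw [← ha, ← hc, e']
    subst this
    have h3 : N * b = N * d := by omega
    have := Nat.eq_of_mul_eq_mul_left (by omega) h3
    rw [this]

theorem box_card_big {N p q : ℕ} (hN : 0 < N) (hp : N ≤ p + 1) (hq : N ≤ q + 1) :
    ((box N p q).filter (· < (N:ℤ) * N)).card = N * N := by
  have : (box N p q).filter (· < (N:ℤ) * N) = Finset.Ico 0 ((N:ℤ) * N) := by
    ext v
    simp only [Finset.mem_filter, Finset.mem_Ico]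
    constructor
    · rintro ⟨h1, h2⟩
      obtain ⟨a, b, _, _, rfl⟩ := mem_box.1 h1
      exact ⟨by positivity, h2⟩
    · rintro ⟨h1, h2⟩
      refine ⟨?_, h2⟩
      lift v to ℕ using h1
      have h2' : v < N * N := by exact_mod_cast h2
      refine mem_box.2 ⟨v % N, v / N, ?_, ?_, ?_⟩
      · have := Nat.mod_lt v hN; omega
      · have := (Nat.div_lt_iff_lt_mul hN).2 h2'; omega
      · rw [Nat.mod_add_div]
  rw [this]
  have h : (N:ℤ) * N = ((N * N : ℕ) : ℤ) := by push_cast; rfl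
  rw [h, Int.card_Ico, sub_zero, Int.toNat_natCast]

theorem Fr.mk0 {Q : ℤ} (L R : Finset ℤ) (hL : ∀ v ∈ L, 0 ≤ v ∧ v < Q)
    (hR : ∀ v ∈ R, 0 ≤ v ∧ v < Q) (L0 : (0:ℤ) ∈ L) (R0 : (0:ℤ) ∈ R) (hQ : 0 < Q) :
    ∃ A, Fr Q A (3 * Q) L R := by
  refine ⟨(L ∪ R.image (fun v => 3 * Q - v)) ∪ Finset.Icc Q (2 * Q), ?_⟩
  have key : ∀ v, v ∈ (L ∪ R.image (fun v => 3 * Q - v)) ∪ Finset.Icc Q (2 * Q) ↔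
      (v ∈ L ∨ 3 * Q - v ∈ R) ∨ (Q ≤ v ∧ v ≤ 2 * Q) := by
    intro v
    simp only [Finset.mem_union, Finset.mem_image, Finset.mem_Icc]
    have : (∃ a ∈ R, 3 * Q - a = v) ↔ 3 * Q - v ∈ R := by
      constructor
      · rintro ⟨a, ha, rfl⟩; simpa using ha
      · intro h; exact ⟨_, h, by ring⟩
    rw [this]
  refine ⟨?_, ?_, ?_, ?_, L0, R0, fun v hv => (hL v hv).1, fun v hv => (hR v hv).1, Or.inr le_rfl⟩
  · intro v hv
    rcases (key v).1 hv with (h | h) | h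
    · have := hL _ h; omega
    · have := hR _ h; omega
    · omega
  · intro v h1 h2
    rw [key]
    constructor
    · rintro ((h | h) | h)
      · exact h
      · have := hR _ h; omega
      · omega
    · intro h; exact Or.inl (Or.inl h)
  · intro v h1 h2
    rw [key]
    constructor
    · rintro ((h | h) | h)
      · have := hL _ h; omega
      · simpa using h
      · omega
    · intro h; exact Or.inl (Or.inr (by simpa using h))
  · intro v h1 h2
    rw [key]; exact Or.inr (by omega)

theorem box_zero_mem (N p q : ℕ) : (0:ℤ) ∈ box N p q :=
  mem_box.2 ⟨0, 0, by omega, by omega, by simp⟩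

/-- The general gadget. -/
theorem gadget0 (j e : ℕ) (hj : 1 ≤ j) (he : e ≤ 1) : ∃ A : Finset ℤ, A.Nonempty ∧
    (∃ c : ℕ, ∀ s d, s + d = j → f A s d =
      (j * j + d + 1) * (j * j + e * s + (1 - e) * d + 1)
      + (j * j + s + 1) * (j * j + e * d + (1 - e) * s + 1) + c) ∧
    (∀ s d s' d', j < s + d → s + d = s' + d' → f A s d = f A s' d') := by
  obtain ⟨N, hN⟩ : ∃ N, N = j * j + j + 1 := ⟨_, rfl⟩
  have hj2 : j ≤ j * j := Nat.le_mul_self j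
  have hQ : (0:ℤ) < (N:ℤ) * N := by
    have : (0:ℤ) < N := by exact_mod_cast (by omega : 0 < N)
    positivity
  obtain ⟨A, hA⟩ := Fr.mk0 (Q := (N:ℤ) * N) (box N j (j + e)) (box N (j + 1) (j + (1 - e)))
    (box_lt (by omega) (by omega)) (box_lt (by omega) (by omega)) (box_zero_mem _ _ _)
    (box_zero_mem _ _ _) hQ
  refine ⟨A, ⟨0, (hA.lo 0 le_rfl hQ).2 hA.L0⟩, ⟨(Finset.Icc ((N:ℤ) * N)
    ((j : ℤ) * (3 * ((N:ℤ) * N)) - (N:ℤ) * N)).card, ?_⟩, ?_⟩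
  · intro s d hsd
    rw [hA.f_eq hQ le_rfl s d (by omega)]
    simp only [gf_box, box_add]
    have e1 : s * j + d * (j + 1) = j * j + d := by rw [← hsd]; ring
    have e2 : s * (j + e) + d * (j + (1 - e)) = j * j + e * s + (1 - e) * d := by
      rw [← hsd]; ring
    have e3 : s * (j + 1) + d * j = j * j + s := by rw [← hsd]; ring
    have e4 : s * (j + (1 - e)) + d * (j + e) = j * j + e * d + (1 - e) * s := by
      rw [← hsd]; ring
    rw [e1, e2, e3, e4, hsd]
    rw [box_card_small, box_card_small]
    all_goals first | omega | (interval_cases e <;> omega)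
  · have key : ∀ s d, j < s + d → f A s d = N * N + N * N + (Finset.Icc ((N:ℤ) * N)
        (((s + d : ℕ) : ℤ) * (3 * ((N:ℤ) * N)) - (N:ℤ) * N)).card := by
      intro s d hsd
      rw [hA.f_eq hQ le_rfl s d (by omega)]
      simp only [gf_box, box_add]
      have g : (j + 1) * j ≤ (s + d) * j := Nat.mul_le_mul_right _ hsd
      rw [box_card_big, box_card_big] <;> first | omega | nlinarith [Nat.zero_le (s * e), Nat.zero_le (d * e), Nat.zero_le (s * (1 - e)), Nat.zero_le (d * (1 - e))]
    intro s d s' d' h1 h2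
    rw [key s d h1, key s' d' (by omega), h2]

theorem gadget (j x y w z : ℕ) (hj : 1 ≤ j) (h1 : x + y = j) (h2 : w + z = j) (h3 : x ≠ w)
    (h4 : x ≠ z) : ∃ A : Finset ℤ, A.Nonempty ∧ f A w z < f A x y ∧
    (∀ s d s' d', j < s + d → s + d = s' + d' → f A s d = f A s' d') := by
  have hne : x * y ≠ w * z := by
    intro h
    have a1 : (x:ℤ) + y = w + z := by exact_mod_cast h1.trans h2.symm
    have a2 : (x:ℤ) * y = w * z := by exact_mod_cast h
    have : ((x:ℤ) - w) * (x - z) = 0 := by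
      have : (y:ℤ) = w + z - x := by linarith
      rw [this] at a2; linarith
    rcases mul_eq_zero.1 this with h | h
    · exact h3 (by omega)
    · exact h4 (by omega)
  rcases lt_or_gt_of_ne hne with h | h
  · obtain ⟨A, hA, ⟨c, hc⟩, h'⟩ := gadget0 j 0 hj (by omega)
    refine ⟨A, hA, ?_, h'⟩
    rw [hc _ _ h1, hc _ _ h2]
    have hs : (x + y) ^ 2 = (w + z) ^ 2 := by rw [h1, h2]
    have hs2 : (j * j) * (x + y) = (j * j) * (w + z) := by rw [h1, h2]
    simp only [Nat.zero_mul, Nat.sub_zero, Nat.one_mul]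
    nlinarith
  · obtain ⟨A, hA, ⟨c, hc⟩, h'⟩ := gadget0 j 1 hj (by omega)
    refine ⟨A, hA, ?_, h'⟩
    rw [hc _ _ h1, hc _ _ h2]
    have hs2 : (j * j) * (x + y) = (j * j) * (w + z) := by rw [h1, h2]
    simp only [Nat.sub_self, Nat.zero_mul, Nat.one_mul]
    nlinarith

theorem exists_pow (F a b : ℕ) (hab : a < b) (ha : 0 < a) : ∃ n : ℕ, F * a ^ n < b ^ n := by
  have ha' : (0:ℝ) < a := by exact_mod_cast ha
  have h : (1:ℝ) < (b:ℝ) / a := by rw [one_lt_div ha']; exact_mod_cast hab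
  obtain ⟨n, hn⟩ := pow_unbounded_of_one_lt (F:ℝ) h
  refine ⟨n, ?_⟩
  rw [div_pow, lt_div_iff₀ (by positivity)] at hn
  exact_mod_cast hn

theorem main (k : ℕ) (x y w z : ℕ → ℕ)
    (hxy : ∀ j, 2 ≤ j → j ≤ k → x j + y j = j)
    (hwz : ∀ j, 2 ≤ j → j ≤ k → w j + z j = j)
    (hxw : ∀ j, 2 ≤ j → j ≤ k → x j ≠ w j)
    (hxz : ∀ j, 2 ≤ j → j ≤ k → x j ≠ z j) (t : ℕ) :
    ∃ A : Finset ℤ, A.Nonempty ∧ ∀ j, 2 ≤ j → j ≤ k → k < j + t →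
      f A (w j) (z j) < f A (x j) (y j) := by
  induction t with
  | zero => exact ⟨{0}, by simp, by intros; omega⟩
  | succ t ih =>
    obtain ⟨A, hA, h⟩ := ih
    by_cases ht : k < 2 + t
    · exact ⟨A, hA, fun j h1 h2 h3 => h j h1 h2 (by omega)⟩
    obtain ⟨i, hi⟩ : ∃ i, i + t = k := ⟨k - t, by omega⟩
    have i2 : 2 ≤ i := by omega
    have ik : i ≤ k := by omega
    obtain ⟨B, hB, hlt, heq⟩ := gadget i (x i) (y i) (w i) (z i) (by omega) (hxy i i2 ik)
      (hwz i i2 ik) (hxw i i2 ik) (hxz i i2 ik)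
    obtain ⟨n, hn⟩ := exists_pow (f A (w i) (z i)) _ _ hlt (f_pos B hB _ _)
    obtain ⟨C, hC, hf⟩ := powLemma A B hA hB k n
    refine ⟨C, hC, fun j h1 h2 h3 => ?_⟩
    have a1 := hxy j h1 h2
    have a2 := hwz j h1 h2
    rw [hf _ _ (by omega), hf _ _ (by omega)]
    by_cases hji : j = i
    · subst hji
      exact lt_of_lt_of_le hn (Nat.le_mul_of_pos_left _ (f_pos A hA _ _))
    · rw [heq (w j) (z j) (x j) (y j) (by omega) (by omega)]
      exact Nat.mul_lt_mul_of_pos_right (h j h1 h2 (by omega)) (pow_pos (f_pos B hB _ _) n)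

theorem main' (k : ℕ) (x y w z : ℕ → ℕ)
    (hxy : ∀ j, 2 ≤ j → j ≤ k → x j + y j = j)
    (hwz : ∀ j, 2 ≤ j → j ≤ k → w j + z j = j)
    (hxw : ∀ j, 2 ≤ j → j ≤ k → x j ≠ w j)
    (hxz : ∀ j, 2 ≤ j → j ≤ k → x j ≠ z j) :
    ∃ A : Finset ℤ, ∀ j, 2 ≤ j → j ≤ k → f A (w j) (z j) < f A (x j) (y j) := by
  obtain ⟨A, _, h⟩ := main k x y w z hxy hwz hxw hxz k
  exact ⟨A, fun j h1 h2 => h j h1 h2 (by omega)⟩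

end GenSD

theorem exists_set_simultaneous_comparisons
    (k : ℕ) (hk : 2 ≤ k) (x y w z : ℕ → ℕ)
    (hxy : ∀ j, 2 ≤ j → j ≤ k → x j + y j = j)
    (hwz : ∀ j, 2 ≤ j → j ≤ k → w j + z j = j)
    (hxw : ∀ j, 2 ≤ j → j ≤ k → x j ≠ w j)
    (hxz : ∀ j, 2 ≤ j → j ≤ k → x j ≠ z j) :
    (∃ A : Finset ℤ, ∀ j, 2 ≤ j → j ≤ k →
      (foldSum (w j) A - foldSum (z j) A).card <
        (foldSum (x j) A - foldSum (y j) A).card) ∧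
    (∀ k' : ℕ, 1 ≤ k' → ∃ A : Finset ℤ, ∀ c, 1 ≤ c → c ≤ k' →
      (foldSum c A - foldSum c A).card < (foldSum c A + foldSum c A).card) := by
  simp only [GenSD.foldSum_eq]
  refine ⟨GenSD.main' k x y w z hxy hwz hxw hxz, fun k' _ => ?_⟩
  obtain ⟨A, h⟩ := GenSD.main' (2 * k') (fun j => j) (fun _ => 0) (fun j => j / 2)
    (fun j => j - j / 2) (by intros; omega) (by intros; omega) (by intros; omega)
    (by intros; omega)
  refine ⟨A, fun c h1 h2 => ?_⟩
  have := h (2 * c) (by omega) (by omega)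
  have e1 : 2 * c / 2 = c := by omega
  have e2 : 2 * c - c = c := by omega
  simp only [e1, e2, GenSD.f] at this
  rw [GenSD.gf_add, ← two_mul]
  simpa [GenSD.gf] using this
end

section
/- Let A = {a₁, a₂, …, a_m} with a₁ < a₂ < … < a_m be a finite set of at least two integers, and let s = gcd(a₂ − a₁, …, a_m − a₁) be the greatest common divisor of the differences of elements of A from its minimum. Then there exist an integer constant C and an integer N with N ≤ (a_m − a₁)/s such that for all k ≥ N, the k-fold sumset satisfies |kA| = k·(a_m − a₁)/s − C. -/
open Finset
open scoped Pointwise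

lemma mem_foldSum (B : Finset ℤ) (k : ℕ) : ∀ n : ℤ, n ∈ foldSum k B ↔
    ∃ l : List ℤ, l.length = k ∧ (∀ a ∈ l, a ∈ B) ∧ l.sum = n := by
  induction k with
  | zero =>
    intro n
    simp only [foldSum, Finset.mem_singleton]
    constructor
    · rintro rfl; exact ⟨[], by simp⟩
    · rintro ⟨l, h1, -, h3⟩
      rw [List.length_eq_zero_iff] at h1
      subst h1; simpa using h3.symm
  | succ k ih =>
    intro n
    simp only [foldSum, Finset.mem_add]
    constructor
    · rintro ⟨a, ha, c, hc, rfl⟩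
      obtain ⟨l, h1, h2, h3⟩ := (ih c).1 hc
      refine ⟨a :: l, by simp [h1], ?_, by simp [h3]⟩
      intro x hx
      rcases List.mem_cons.1 hx with rfl | hx
      · exact ha
      · exact h2 x hx
    · rintro ⟨l, h1, h2, h3⟩
      cases l with
      | nil => simp at h1
      | cons a l =>
        refine ⟨a, h2 a (by simp), l.sum, (ih _).2 ⟨l, by simpa using h1, fun x hx => h2 x (by simp [hx]), rfl⟩, by simpa using h3⟩

lemma hull_edge (F : Finset (ℤ × ℤ)) (n m : ℤ) (h0 : ∀ p ∈ F, n < p.1 ∨ m < p.2)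
    (P0 Q0 : ℤ × ℤ) (hP : P0 ∈ F) (hQ : Q0 ∈ F) (hP1 : P0.1 ≤ n) (hQ1 : Q0.2 ≤ m)
    (hP2 : P0.1 + P0.2 < n + m) (hQ2 : Q0.1 + Q0.2 < n + m) :
    ∃ α β c : ℤ, 0 < α ∧ 0 < β ∧ (∀ p ∈ F, c ≤ α * p.1 + β * p.2) ∧ c < α * n + β * m ∧
      (∃ P ∈ F, P.1 ≤ n ∧ α * P.1 + β * P.2 = c) ∧ ∃ Q ∈ F, Q.2 ≤ m ∧ α * Q.1 + β * Q.2 = c := by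
  classical
  have hQn : n < Q0.1 := by
    rcases h0 Q0 hQ with h | h
    · exact h
    · omega
  let G := (F ×ˢ F).filter (fun z => z.1.1 ≤ n ∧ n < z.2.1)
  let h : (ℤ × ℤ) × (ℤ × ℤ) → ℚ := fun z =>
    ((z.1.2 * (z.2.1 - n) + z.2.2 * (n - z.1.1) : ℤ) : ℚ) / ((z.2.1 - z.1.1 : ℤ) : ℚ)
  have hlt : ∀ z w : (ℤ × ℤ) × (ℤ × ℤ), z.1.1 ≤ n → n < z.2.1 → w.1.1 ≤ n → n < w.2.1 →
      h z ≤ h w → (z.1.2 * (z.2.1 - n) + z.2.2 * (n - z.1.1)) * (w.2.1 - w.1.1) ≤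
        (w.1.2 * (w.2.1 - n) + w.2.2 * (n - w.1.1)) * (z.2.1 - z.1.1) := by
    intro z w a1 a2 a3 a4 hh
    have e1 : (0 : ℚ) < ((z.2.1 - z.1.1 : ℤ) : ℚ) := by exact_mod_cast (by omega)
    have e2 : (0 : ℚ) < ((w.2.1 - w.1.1 : ℤ) : ℚ) := by exact_mod_cast (by omega)
    have := (div_le_div_iff₀ e1 e2).1 hh
    exact_mod_cast this
  have hG : (P0, Q0) ∈ G := by simp [G, hP, hQ, hP1, hQn]
  obtain ⟨⟨P, Q⟩, hz, hmin⟩ := G.exists_min_image h ⟨_, hG⟩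
  have hmem : (P ∈ F ∧ Q ∈ F) ∧ P.1 ≤ n ∧ n < Q.1 := by simpa [G] using hz
  obtain ⟨⟨hPF, hQF⟩, hPn, hQn'⟩ := hmem
  have hPm : m < P.2 := by
    rcases h0 P hPF with h | h
    · omega
    · exact h
  have key := hlt (P, Q) (P0, Q0) hPn hQn' hP1 hQn (hmin _ hG)
  simp only at key
  have hlow : (P.2 * (Q.1 - n) + Q.2 * (n - P.1)) < m * (Q.1 - P.1) := by
    have e : P0.2 * (Q0.1 - n) + Q0.2 * (n - P0.1) < m * (Q0.1 - P0.1) := by nlinarith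
    by_contra hcon
    push Not at hcon
    have e1 : 0 < Q.1 - P.1 := by omega
    have e2 : 0 < Q0.1 - P0.1 := by omega
    nlinarith
  have hPn' : P.1 < n := by
    rcases lt_or_eq_of_le hPn with h | h
    · exact h
    · rw [h] at hlow
      nlinarith
  have hQm : Q.2 < m := by
    by_contra hcon
    push Not at hcon
    nlinarith
  refine ⟨P.2 - Q.2, Q.1 - P.1, P.2 * Q.1 - Q.2 * P.1, by omega, by omega, ?_, by nlinarith,
    ⟨P, hPF, hPn, by ring⟩, ⟨Q, hQF, hQm.le, by ring⟩⟩
  intro R hR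
  by_contra hcon
  push Not at hcon
  rcases le_or_gt R.1 n with hl | hl
  · have := hlt (P, Q) (R, Q) hPn hQn' hl hQn' (hmin _ (by simp [G, hR, hQF, hl, hQn']))
    simp only at this
    nlinarith [mul_lt_mul_of_pos_left hcon (show 0 < Q.1 - n by omega)]
  · have := hlt (P, Q) (P, R) hPn hQn' hPn hl (hmin _ (by simp [G, hR, hPF, hl, hPn]))
    simp only at this
    nlinarith [mul_lt_mul_of_pos_left hcon (show 0 < n - P.1 by omega)]

lemma list_bounds (B : Finset ℤ) (b : ℤ) (hB : ∀ a ∈ B, 0 ≤ a ∧ a ≤ b) (l : List ℤ)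
    (hl : ∀ a ∈ l, a ∈ B) : 0 ≤ l.sum ∧ l.sum ≤ b * l.length := by
  induction l with
  | nil => simp
  | cons a l ih =>
    have h1 := ih (fun x hx => hl x (by simp [hx]))
    have h2 := hB a (hl a (by simp))
    simp only [List.sum_cons, List.length_cons]
    push_cast
    constructor <;> nlinarith

lemma reduce_list (B : Finset ℤ) (b : ℕ) (hb : 0 < b) (hB : ∀ a ∈ B, 0 ≤ a ∧ a ≤ (b : ℤ)) :
    ∀ (N : ℕ) (l : List ℤ), l.length ≤ N → (∀ a ∈ l, a ∈ B) →
    ∃ l' : List ℤ, l'.length < b ∧ (∀ a ∈ l', a ∈ B) ∧ l'.sum ≡ l.sum [ZMOD b] ∧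
      l'.sum ≤ l.sum ∧ (b : ℤ) * l'.length - l'.sum ≤ b * l.length - l.sum := by
  intro N
  induction N with
  | zero =>
    intro l h1 h2
    exact ⟨l, by omega, h2, Int.ModEq.refl _, le_refl _, le_refl _⟩
  | succ N ih =>
    intro l h1 h2
    by_cases hlen : l.length < b
    · exact ⟨l, by omega, h2, Int.ModEq.refl _, le_refl _, le_refl _⟩
    have : NeZero b := ⟨by omega⟩
    obtain ⟨i, hi, j, hj, hij, he⟩ := Finset.exists_ne_map_eq_of_card_lt_of_maps_to
      (s := Finset.range (b + 1)) (t := (Finset.univ : Finset (ZMod b)))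
      (by simp [ZMod.card]) (f := fun i => (((l.take i).sum : ℤ) : ZMod b)) (by simp [Set.MapsTo])
    wlog hlt : i < j generalizing i j
    · exact this j hj i hi hij.symm he.symm (by omega)
    simp only [Finset.mem_range] at hi hj
    have he' := (ZMod.intCast_eq_intCast_iff _ _ _).1 he
    let z := (l.take j).drop i
    have hz : l.take j = l.take i ++ z := by
      have := List.take_append_drop i (l.take j)
      rw [List.take_take, min_eq_left hlt.le] at this
      exact this.symm
    have hl : l = l.take i ++ z ++ l.drop j := by
      rw [← hz, List.take_append_drop]
    have hzl : z.length = j - i := by simp [z]; omega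
    have hzB : ∀ a ∈ z, a ∈ B := fun a ha => h2 a (List.mem_of_mem_take (List.mem_of_mem_drop ha))
    have hzb := list_bounds B b hB z hzB
    have hs : l.sum = (l.take i).sum + z.sum + (l.drop j).sum := by
      conv_lhs => rw [hl]
      simp [List.sum_append, add_assoc]
    have hn : l.length = (l.take i).length + z.length + (l.drop j).length := by
      conv_lhs => rw [hl]
      simp only [List.length_append]
    obtain ⟨l', g1, g2, g3, g4, g5⟩ := ih (l.take i ++ l.drop j) (by
      rw [List.length_append]; omega) (by
      intro a ha
      rcases List.mem_append.1 ha with h | h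
      · exact h2 a (List.mem_of_mem_take h)
      · exact h2 a (List.mem_of_mem_drop h))
    rw [List.sum_append] at g3 g4 g5
    rw [List.length_append] at g5
    refine ⟨l', g1, g2, g3.trans ?_, by omega, ?_⟩
    · rw [hs, ← List.sum_append, ← List.sum_append, ← List.sum_append, ← hz]
      rw [List.sum_append, List.sum_append]
      exact Int.ModEq.add_right _ he'
    · rw [hs, hn]; push_cast at g5 ⊢; nlinarith

lemma fill (B : Finset ℤ) (b : ℕ) (hb : 0 < b) (h0 : (0 : ℤ) ∈ B) (hbB : (b : ℤ) ∈ B)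
    (l : List ℤ) (hl : ∀ a ∈ l, a ∈ B) (n : ℤ) (k : ℕ) (hmod : l.sum ≡ n [ZMOD b])
    (h1 : l.sum ≤ n) (h2 : (b : ℤ) * l.length - l.sum ≤ k * b - n) : n ∈ foldSum k B := by
  obtain ⟨q, hq⟩ := hmod.dvd
  have hb' : (0 : ℤ) < b := by exact_mod_cast hb
  have hq0 : 0 ≤ q := by
    by_contra hc
    push Not at hc
    nlinarith
  have hq1 : l.length + q ≤ k := by
    by_contra hc
    push Not at hc
    nlinarith
  lift q to ℕ using hq0
  have hq2 : l.length + q ≤ k := by exact_mod_cast hq1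
  rw [mem_foldSum]
  refine ⟨l ++ List.replicate q (b : ℤ) ++ List.replicate (k - (l.length + q)) 0, by
    simp; omega, ?_, ?_⟩
  · intro a ha
    simp only [List.mem_append, List.mem_replicate] at ha
    rcases ha with (h | h) | h
    · exact hl a h
    · rw [h.2]; exact hbB
    · rw [h.2]; exact h0
  · simp [List.sum_append]
    linarith

lemma path_count (B : Finset ℤ) (b : ℕ) (hb : 0 < b) (hB : ∀ a ∈ B, 0 ≤ a ∧ a ≤ (b : ℤ))
    (n m : ℤ) (α β c : ℤ) (hα : 0 < α) (hβ : 0 < β)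
    (hmin : ∀ l : List ℤ, (∀ a ∈ l, a ∈ B) → l.sum ≡ n [ZMOD b] →
      c ≤ α * l.sum + β * (b * l.length - l.sum))
    (hT : c < α * n + β * m)
    (h : ℕ) : ∀ (u s t : List ℤ), s.length + t.length = h →
      (∀ a ∈ u, a ∈ B) → (∀ a ∈ s, a ∈ B) → (∀ a ∈ t, a ∈ B) →
      (u ++ s).sum ≡ n [ZMOD b] → (u ++ t).sum ≡ n [ZMOD b] →
      (u ++ s).sum ≤ n → (b : ℤ) * (u ++ t).length - (u ++ t).sum ≤ m →
      α * (u ++ s).sum + β * (b * (u ++ s).length - (u ++ s).sum) = c →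
      α * (u ++ t).sum + β * (b * (u ++ t).length - (u ++ t).sum) = c →
      ∃ u s t : List ℤ, (u.length + s.length + t.length ≤ b) ∧
      (∀ a ∈ u, a ∈ B) ∧ (∀ a ∈ s, a ∈ B) ∧ (∀ a ∈ t, a ∈ B) ∧
      (u ++ s).sum ≡ n [ZMOD b] ∧ (u ++ t).sum ≡ n [ZMOD b] ∧
      (u ++ s).sum ≤ n ∧ (b : ℤ) * (u ++ t).length - (u ++ t).sum ≤ m := by
  induction h using Nat.strong_induction_on with
  | _ h ih =>
  intro u s t hh hu hs ht cs ct ls lt es et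
  have : NeZero b := ⟨by omega⟩
  by_cases hle : u.length + s.length + t.length ≤ b
  · exact ⟨u, s, t, hle, hu, hs, ht, cs, ct, ls, lt⟩
  -- no zero-sum infix in an optimal list
  have nz : ∀ x z y : List ℤ, (∀ a ∈ x ++ z ++ y, a ∈ B) → (x ++ z ++ y).sum ≡ n [ZMOD b] →
      α * (x ++ z ++ y).sum + β * (b * (x ++ z ++ y).length - (x ++ z ++ y).sum) = c →
      x.sum ≡ (x ++ z).sum [ZMOD b] → z.length = 0 := by
    intro x z y h1 h2 h3 h4
    have hz := list_bounds B b hB z (fun a ha => h1 a (by simp [ha]))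
    have := hmin (x ++ y) (fun a ha => h1 a (by
      rcases List.mem_append.1 ha with h | h <;> simp [h])) (by
        refine Int.ModEq.trans ?_ h2
        rw [List.sum_append, List.sum_append]
        exact Int.ModEq.add_right _ h4)
    simp only [List.sum_append, List.length_append, Nat.cast_add] at h3 this
    by_contra hne
    have hz1 : (1 : ℤ) ≤ z.length := by exact_mod_cast (by omega)
    have hb' : (0 : ℤ) < b := by exact_mod_cast hb
    have e1 : 0 ≤ α * z.sum + β * (b * z.length - z.sum) := by
      have := mul_nonneg hα.le hz.1
      have := mul_nonneg hβ.le (sub_nonneg.2 hz.2)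
      linarith
    have e2 : α * z.sum + β * (b * z.length - z.sum) ≤ 0 := by linarith
    have e3 : α * z.sum = 0 := by
      have := mul_nonneg hα.le hz.1
      have := mul_nonneg hβ.le (sub_nonneg.2 hz.2)
      linarith
    have e4 : z.sum = 0 := by
      rcases mul_eq_zero.1 e3 with h | h
      · omega
      · exact h
    rw [e4] at e2
    have : 0 < β * (b * z.length - 0) := by
      rw [sub_zero]; positivity
    linarith
  by_contra hno
  let f : ℕ → ZMod b := fun i => ((((u ++ s).take i).sum : ℤ) : ZMod b)
  let g : ℕ → ZMod b := fun j => (((u ++ t.take j).sum : ℤ) : ZMod b)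
  have hf : Set.InjOn f (Finset.range (u.length + s.length + 1)) := by
    intro i hi j hj he
    by_contra hij
    wlog hlt : i < j generalizing i j
    · exact this hj hi he.symm (fun h => hij h.symm) (by omega)
    have hi' : i < u.length + s.length + 1 := by simpa using hi
    have hj' : j < u.length + s.length + 1 := by simpa using hj
    have he' := (ZMod.intCast_eq_intCast_iff _ _ _).1 he
    have hz : (u ++ s).take j = (u ++ s).take i ++ ((u ++ s).take j).drop i := by
      have := List.take_append_drop i ((u ++ s).take j)
      rw [List.take_take, min_eq_left hlt.le] at this
      exact this.symm
    have hl : (u ++ s).take i ++ ((u ++ s).take j).drop i ++ (u ++ s).drop j = u ++ s := by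
      rw [← hz, List.take_append_drop]
    have := nz ((u ++ s).take i) (((u ++ s).take j).drop i) ((u ++ s).drop j) (by
      rw [hl]; intro a ha
      rcases List.mem_append.1 ha with h | h
      · exact hu a h
      · exact hs a h) (by rw [hl]; exact cs) (by rw [hl]; exact es) (by rw [← hz]; exact he')
    rw [List.length_drop, List.length_take, List.length_append] at this
    omega
  have hg : Set.InjOn g (Finset.Ico 1 t.length) := by
    intro i hi j hj he
    by_contra hij
    wlog hlt : i < j generalizing i j
    · exact this hj hi he.symm (fun h => hij h.symm) (by omega)
    have hi' := Finset.mem_Ico.1 (Finset.mem_coe.1 hi)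
    have hj' := Finset.mem_Ico.1 (Finset.mem_coe.1 hj)
    have he' := (ZMod.intCast_eq_intCast_iff _ _ _).1 he
    have hz : t.take j = t.take i ++ (t.take j).drop i := by
      have := List.take_append_drop i (t.take j)
      rw [List.take_take, min_eq_left hlt.le] at this
      exact this.symm
    have hl : (u ++ t.take i) ++ (t.take j).drop i ++ t.drop j = u ++ t := by
      rw [List.append_assoc u, ← hz, List.append_assoc, List.take_append_drop]
    have := nz (u ++ t.take i) ((t.take j).drop i) (t.drop j) (by
      rw [hl]; intro a ha
      rcases List.mem_append.1 ha with h | h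
      · exact hu a h
      · exact ht a h) (by rw [hl]; exact ct) (by rw [hl]; exact et)
      (by rw [List.append_assoc u, ← hz]; exact he')
    rw [List.length_drop, List.length_take] at this
    omega
  have hd : Disjoint ((Finset.range (u.length + s.length + 1)).image f)
      ((Finset.Ico 1 t.length).image g) := by
    rw [Finset.disjoint_left]
    intro v hv1 hv2
    obtain ⟨i, hi, rfl⟩ := Finset.mem_image.1 hv1
    obtain ⟨j, hj, he⟩ := Finset.mem_image.1 hv2
    have hi' := Finset.mem_range.1 hi
    have hj' := Finset.mem_Ico.1 hj
    have he' := (ZMod.intCast_eq_intCast_iff _ _ _).1 he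
    rcases le_or_gt i u.length with hiu | hiu
    · rw [List.take_append_of_le_length hiu] at he'
      have e1 : u.take i ++ (u.drop i ++ t.take j) = u ++ t.take j := by
        rw [← List.append_assoc, List.take_append_drop]
      have hl : u.take i ++ (u.drop i ++ t.take j) ++ t.drop j = u ++ t := by
        rw [e1, List.append_assoc, List.take_append_drop]
      have := nz (u.take i) (u.drop i ++ t.take j) (t.drop j) (by
        rw [hl]; intro a ha
        rcases List.mem_append.1 ha with h | h
        · exact hu a h
        · exact ht a h) (by rw [hl]; exact ct) (by rw [hl]; exact et)
        (by rw [e1]; exact he'.symm)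
      rw [List.length_append, List.length_take] at this
      omega
    · obtain ⟨i, rfl⟩ : ∃ i', i = u.length + i' := ⟨i - u.length, by omega⟩
      rw [List.take_length_add_append, List.sum_append, List.sum_append] at he'
      have he2 : (t.take j).sum ≡ (s.take i).sum [ZMOD b] := Int.ModEq.add_left_cancel' _ he'
      obtain ⟨S1, S2, hS, hS1⟩ : ∃ S1 S2, s = S1 ++ S2 ∧ s.take i = S1 :=
        ⟨_, _, (List.take_append_drop i s).symm, rfl⟩
      obtain ⟨T1, T2, hT', hT1, hT1l⟩ : ∃ T1 T2, t = T1 ++ T2 ∧ t.take j = T1 ∧ T1.length = j :=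
        ⟨_, _, (List.take_append_drop j t).symm, rfl, by rw [List.length_take]; omega⟩
      rw [hS1, hT1] at he2
      subst hS hT'
      have hS1B : ∀ a ∈ S1, a ∈ B := fun a ha => hs a (by simp [ha])
      have hS2B : ∀ a ∈ S2, a ∈ B := fun a ha => hs a (by simp [ha])
      have hT1B : ∀ a ∈ T1, a ∈ B := fun a ha => ht a (by simp [ha])
      have hT2B : ∀ a ∈ T2, a ∈ B := fun a ha => ht a (by simp [ha])
      simp only [List.length_append] at hj' hh
      have mem3 : ∀ x y z : List ℤ, (∀ a ∈ x, a ∈ B) → (∀ a ∈ y, a ∈ B) → (∀ a ∈ z, a ∈ B) →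
          ∀ a ∈ x ++ (y ++ z), a ∈ B := by
        intro x y z h1 h2 h3 a ha
        rcases List.mem_append.1 ha with h | h
        · exact h1 a h
        · rcases List.mem_append.1 h with h | h
          · exact h2 a h
          · exact h3 a h
      have mem2 : ∀ x y : List ℤ, (∀ a ∈ x, a ∈ B) → (∀ a ∈ y, a ∈ B) →
          ∀ a ∈ x ++ y, a ∈ B := by
        intro x y h1 h2 a ha
        rcases List.mem_append.1 ha with h | h
        · exact h1 a h
        · exact h2 a h
      have cR : (u ++ (T1 ++ S2)).sum ≡ n [ZMOD b] := by
        refine Int.ModEq.trans ?_ cs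
        simp only [List.sum_append]
        exact Int.ModEq.add_left _ (Int.ModEq.add_right _ he2)
      have cR' : (u ++ (S1 ++ T2)).sum ≡ n [ZMOD b] := by
        refine Int.ModEq.trans ?_ ct
        simp only [List.sum_append]
        exact Int.ModEq.add_left _ (Int.ModEq.add_right _ he2.symm)
      have m1 := hmin _ (mem3 u T1 S2 hu hT1B hS2B) cR
      have m2 := hmin _ (mem3 u S1 T2 hu hS1B hT2B) cR'
      simp only [List.sum_append, List.length_append, Nat.cast_add] at m1 m2 es et cs ct cR ls lt
      have eR : α * (u.sum + (T1.sum + S2.sum)) + β * (b * (u.length + (T1.length + S2.length))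
          - (u.sum + (T1.sum + S2.sum))) = c := by linarith
      have side : u.sum + (T1.sum + S2.sum) ≤ n ∨
          b * (u.length + (T1.length + S2.length)) - (u.sum + (T1.sum + S2.sum)) ≤ m := by
        by_contra hcon
        push Not at hcon
        have := mul_lt_mul_of_pos_left hcon.1 hα
        have := mul_lt_mul_of_pos_left hcon.2 hβ
        linarith
      rcases side with hsd | hsd
      · apply hno
        refine ih (S2.length + T2.length) (by omega) (u ++ T1) S2 T2 rfl (mem2 _ _ hu hT1B) hS2B
          hT2B ?_ ?_ ?_ ?_ ?_ ?_ <;>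
          simp only [List.sum_append, List.length_append, Nat.cast_add, add_assoc] <;> assumption
      · apply hno
        refine ih (S1.length + T1.length) (by omega) (u ++ S2) S1 T1 rfl (mem2 _ _ hu hS2B) hS1B
          hT1B ?_ ?_ ?_ ?_ ?_ ?_ <;>
          simp only [List.sum_append, List.length_append, Nat.cast_add, add_assoc,
            add_comm S2.sum, add_comm (S2.length : ℤ)] <;> assumption
  have hcard := Finset.card_le_univ (((Finset.range (u.length + s.length + 1)).image f) ∪
      ((Finset.Ico 1 t.length).image g))
  rw [Finset.card_union_of_disjoint hd, Finset.card_image_of_injOn hf,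
    Finset.card_image_of_injOn hg, ZMod.card, Finset.card_range, Nat.card_Ico] at hcard
  omega

lemma structure_mem (B : Finset ℤ) (b : ℕ) (hb : 0 < b) (hB : ∀ a ∈ B, 0 ≤ a ∧ a ≤ (b : ℤ))
    (h0 : (0 : ℤ) ∈ B) (hbB : (b : ℤ) ∈ B) (n : ℤ) (k : ℕ) (hk : b ≤ k)
    (l1 l2 : List ℤ) (hl1 : ∀ a ∈ l1, a ∈ B) (hl2 : ∀ a ∈ l2, a ∈ B)
    (c1 : l1.sum ≡ n [ZMOD b]) (c2 : l2.sum ≡ n [ZMOD b]) (g1 : l1.sum ≤ n)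
    (g2 : (b : ℤ) * l2.length - l2.sum ≤ k * b - n) : n ∈ foldSum k B := by
  classical
  by_contra hn
  have hb' : (0 : ℤ) < b := by exact_mod_cast hb
  have hk' : (b : ℤ) ≤ k := by exact_mod_cast hk
  have hmiss : ∀ l : List ℤ, (∀ a ∈ l, a ∈ B) → l.sum ≡ n [ZMOD b] →
      n < l.sum ∨ (k * b - n : ℤ) < b * l.length - l.sum := by
    intro l hl hc
    by_contra hcon
    push Not at hcon
    exact hn (fill B b hb h0 hbB l hl n k hc hcon.1 hcon.2)
  let F : Finset (ℤ × ℤ) := ((Finset.Icc 0 ((b : ℤ) * b)) ×ˢ (Finset.Icc 0 ((b : ℤ) * b))).filter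
    (fun p => ∃ l : List ℤ, (∀ a ∈ l, a ∈ B) ∧ l.sum ≡ n [ZMOD b] ∧ l.sum = p.1 ∧
      (b : ℤ) * l.length - l.sum = p.2)
  have hF1 : ∀ p ∈ F, ∃ l : List ℤ, (∀ a ∈ l, a ∈ B) ∧ l.sum ≡ n [ZMOD b] ∧ l.sum = p.1 ∧
      (b : ℤ) * l.length - l.sum = p.2 := fun p hp => (Finset.mem_filter.1 hp).2
  have hF2 : ∀ l : List ℤ, l.length < b → (∀ a ∈ l, a ∈ B) → l.sum ≡ n [ZMOD b] →
      (l.sum, (b : ℤ) * l.length - l.sum) ∈ F := by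
    intro l h1 h2 h3
    have hbd := list_bounds B b hB l h2
    have : (l.length : ℤ) < b := by exact_mod_cast h1
    have : (b : ℤ) * l.length ≤ b * b := by nlinarith
    simp only [F, Finset.mem_filter, Finset.mem_product, Finset.mem_Icc]
    exact ⟨⟨⟨by omega, by omega⟩, by omega, by omega⟩, l, h2, h3, rfl, rfl⟩
  obtain ⟨p, p1, p2, p3, p4, p5⟩ := reduce_list B b hb hB _ l1 le_rfl hl1
  obtain ⟨q, q1, q2, q3, q4, q5⟩ := reduce_list B b hb hB _ l2 le_rfl hl2
  have short : ∀ l : List ℤ, l.length < b → l.sum + ((b : ℤ) * l.length - l.sum) < n + (k * b - n) := by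
    intro l hl
    have : (l.length : ℤ) < b := by exact_mod_cast hl
    nlinarith
  obtain ⟨α, β, c, hα, hβ, hmin, hT, ⟨P, hP, hPn, hPc⟩, ⟨Q, hQ, hQn, hQc⟩⟩ :=
    hull_edge F n (k * b - n) (by
      intro p hp
      obtain ⟨l, a1, a2, a3, a4⟩ := hF1 p hp
      rw [← a3, ← a4]; exact hmiss l a1 a2) _ _ (hF2 p p1 p2 (p3.trans c1))
      (hF2 q q1 q2 (q3.trans c2)) (p4.trans g1) (q5.trans g2) (short p p1) (short q q1)
  obtain ⟨s, s1, s2, s3, s4⟩ := hF1 P hP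
  obtain ⟨t, t1, t2, t3, t4⟩ := hF1 Q hQ
  rw [← s3, ← s4] at hPc
  rw [← t3, ← t4] at hQc
  rw [← s3] at hPn
  rw [← t4] at hQn
  obtain ⟨u, s, t, hlen, hu, hs, ht, cs, ct, ls, lt⟩ := path_count B b hb hB n (k * b - n) α β c
    hα hβ (by
      intro l hl hc
      obtain ⟨p, p1, p2, p3, p4, p5⟩ := reduce_list B b hb hB _ l le_rfl hl
      have := hmin _ (hF2 p p1 p2 (p3.trans hc))
      have := mul_le_mul_of_nonneg_left p4 hα.le
      have := mul_le_mul_of_nonneg_left p5 hβ.le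
      simp only at *
      linarith) hT _ [] s t rfl (by simp) s1 t1 s2 t2 hPn hQn hPc hQc
  have mem2 : ∀ x y : List ℤ, (∀ a ∈ x, a ∈ B) → (∀ a ∈ y, a ∈ B) →
      ∀ a ∈ x ++ y, a ∈ B := by
    intro x y h1 h2 a ha
    rcases List.mem_append.1 ha with h | h
    · exact h1 a h
    · exact h2 a h
  have hs' := hmiss _ (mem2 u s hu hs) cs
  have ht' := hmiss _ (mem2 u t hu ht) ct
  have bs := list_bounds B b hB s hs
  have bt := list_bounds B b hB t ht
  simp only [List.sum_append, List.length_append, Nat.cast_add] at hs' ht' ls lt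
  have e1 : (k * b - n : ℤ) < b * (u.length + s.length) - (u.sum + s.sum) := by
    rcases hs' with h | h
    · omega
    · exact h
  have e2 : n < u.sum + t.sum := by
    rcases ht' with h | h
    · exact h
    · omega
  have hlen' : (u.length + s.length + t.length : ℤ) ≤ b := by exact_mod_cast hlen
  have e3 := mul_le_mul_of_nonneg_left hlen' hb'.le
  have e4 := mul_le_mul_of_nonneg_left hk' hb'.le
  linarith [bs.1, bt.2]

lemma exists_min_list (B : Finset ℤ) (b : ℕ) (hb : 0 < b) (hB : ∀ a ∈ B, 0 ≤ a ∧ a ≤ (b : ℤ))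
    (r : ℤ) (hr : ∃ l : List ℤ, (∀ a ∈ l, a ∈ B) ∧ l.sum ≡ r [ZMOD b]) :
    ∃ l : List ℤ, l.length < b ∧ (∀ a ∈ l, a ∈ B) ∧ l.sum ≡ r [ZMOD b] ∧
      ∀ l' : List ℤ, (∀ a ∈ l', a ∈ B) → l'.sum ≡ r [ZMOD b] →
        (b : ℤ) * l.length - l.sum ≤ b * l'.length - l'.sum := by
  classical
  have hex : ∃ v : ℕ, ∃ l : List ℤ, (∀ a ∈ l, a ∈ B) ∧ l.sum ≡ r [ZMOD b] ∧
      (b : ℤ) * l.length - l.sum = v := by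
    obtain ⟨l, h1, h2⟩ := hr
    have := list_bounds B b hB l h1
    exact ⟨((b : ℤ) * l.length - l.sum).toNat, l, h1, h2, by omega⟩
  obtain ⟨l, h1, h2, h3⟩ := Nat.find_spec hex
  obtain ⟨p, p1, p2, p3, p4, p5⟩ := reduce_list B b hb hB _ l le_rfl h1
  refine ⟨p, p1, p2, p3.trans h2, ?_⟩
  intro l' g1 g2
  have hbd := list_bounds B b hB l' g1
  have := Nat.find_min' hex (m := ((b : ℤ) * l'.length - l'.sum).toNat)
    ⟨l', g1, g2, by omega⟩
  omega

lemma card_step (B : Finset ℤ) (b : ℕ) (hb : 0 < b) (hB : ∀ a ∈ B, 0 ≤ a ∧ a ≤ (b : ℤ))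
    (h0 : (0 : ℤ) ∈ B) (hbB : (b : ℤ) ∈ B)
    (hall : ∀ r : ℤ, ∃ l : List ℤ, (∀ a ∈ l, a ∈ B) ∧ l.sum ≡ r [ZMOD b])
    (k : ℕ) (hk : b ≤ k) : (foldSum (k + 1) B).card = (foldSum k B).card + b := by
  classical
  have hb' : (0 : ℤ) < b := by exact_mod_cast hb
  have hk' : (b : ℤ) ≤ k := by exact_mod_cast hk
  choose L L1 L2 L3 L4 using fun r => exists_min_list B b hb hB r (hall r)
  let φ : ℕ → ℤ := fun r => ((k : ℤ) + 1) * b - (b * (L r).length - (L r).sum)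
  have hφ : ∀ r : ℕ, φ r ≡ r [ZMOD b] := by
    intro r
    refine Int.ModEq.trans ?_ (L3 r)
    refine (Int.modEq_iff_dvd.2 ⟨(L r).length - (k + 1), ?_⟩)
    simp only [φ]; ring
  have hinj : Set.InjOn φ (Finset.range b) := by
    intro i hi j hj he
    have hi' : i < b := by simpa using hi
    have hj' : j < b := by simpa using hj
    have := (hφ i).symm.trans ((congrArg (· ≡ (j : ℤ) [ZMOD b]) he).mpr (hφ j))
    have h2 := Int.natCast_modEq_iff.1 this
    exact Nat.ModEq.eq_of_lt_of_lt h2 hi' hj'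
  have hdis : Disjoint (foldSum k B) ((Finset.range b).image φ) := by
    rw [Finset.disjoint_left]
    intro n hn hn2
    obtain ⟨r, hr, rfl⟩ := Finset.mem_image.1 hn2
    obtain ⟨l, h1, h2, h3⟩ := (mem_foldSum B k _).1 hn
    have := L4 r l h2 (by rw [h3]; exact hφ r)
    rw [h1, h3] at this
    simp only [φ] at this
    linarith
  have hun : foldSum (k + 1) B = foldSum k B ∪ (Finset.range b).image φ := by
    ext n
    rw [Finset.mem_union]
    constructor
    · intro hn
      obtain ⟨l, h1, h2, h3⟩ := (mem_foldSum B _ _).1 hn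
      have hr0 := Int.emod_nonneg n hb'.ne'
      have hr1 := Int.emod_lt_of_pos n hb'
      obtain ⟨r, hr⟩ : ∃ r : ℕ, (r : ℤ) = n % b := ⟨(n % b).toNat, by omega⟩
      have hnr : n ≡ r [ZMOD b] := by rw [hr]; exact (Int.mod_modEq n b).symm
      have hle := L4 r l h2 (by rw [h3]; exact hnr)
      rw [h1, h3] at hle
      push_cast at hle
      obtain ⟨q, hq⟩ := ((hnr.trans (L3 r).symm)).dvd
      by_cases he : n = φ r
      · right
        exact Finset.mem_image.2 ⟨r, Finset.mem_range.2 (by omega), he.symm⟩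
      · left
        refine structure_mem B b hb hB h0 hbB n k hk l (L r) h2 (L2 r) (by rw [h3]) 
          ((L3 r).trans hnr.symm) h3.le ?_
        have e : φ r - n = b * (k + 1 - (L r).length + q) := by
          simp only [φ]; linear_combination hq
        have e0 : 0 ≤ φ r - n := by simp only [φ]; linarith
        have e1 : (1 : ℤ) ≤ k + 1 - (L r).length + q := by
          by_contra hc
          have : (k + 1 - (L r).length + q : ℤ) ≤ 0 := by omega
          have : (b : ℤ) * (k + 1 - (L r).length + q) ≤ 0 := by nlinarith
          omega
        have e2 : (b : ℤ) ≤ φ r - n := by rw [e]; nlinarith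
        simp only [φ] at e2
        linarith
    · rintro (hn | hn)
      · obtain ⟨l, h1, h2, h3⟩ := (mem_foldSum B _ _).1 hn
        exact (mem_foldSum B _ _).2 ⟨0 :: l, by simp [h1], by
          intro a ha
          rcases List.mem_cons.1 ha with rfl | h
          · exact h0
          · exact h2 a h, by simp [h3]⟩
      · obtain ⟨r, hr, rfl⟩ := Finset.mem_image.1 hn
        refine fill B b hb h0 hbB (L r) (L2 r) _ _ ((L3 r).trans (hφ r).symm) ?_ ?_
        · have : ((L r).length : ℤ) < b := by exact_mod_cast L1 r
          simp only [φ]; nlinarith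
        · simp only [φ]; push_cast; linarith
  rw [hun, Finset.card_union_of_disjoint hdis, Finset.card_image_of_injOn hinj, Finset.card_range]

lemma list_of_coeffs (B : Finset ℤ) (f : ℤ → ℕ) (C : Finset ℤ) (hC : C ⊆ B) :
    ∃ l : List ℤ, (∀ a ∈ l, a ∈ B) ∧ l.sum = ∑ a ∈ C, a * (f a : ℤ) := by
  classical
  induction C using Finset.induction_on with
  | empty => exact ⟨[], by simp⟩
  | insert a C ha ih =>
    obtain ⟨l, h1, h2⟩ := ih (fun x hx => hC (Finset.mem_insert_of_mem hx))
    refine ⟨List.replicate (f a) a ++ l, ?_, ?_⟩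
    · intro x hx
      rcases List.mem_append.1 hx with h | h
      · rw [(List.mem_replicate.1 h).2]; exact hC (Finset.mem_insert_self _ _)
      · exact h1 x h
    · rw [Finset.sum_insert ha, List.sum_append, h2]
      simp [mul_comm]

lemma all_classes (B : Finset ℤ) (b : ℕ) (hb : 0 < b) (hg : B.gcd id = 1) (r : ℤ) :
    ∃ l : List ℤ, (∀ a ∈ l, a ∈ B) ∧ l.sum ≡ r [ZMOD b] := by
  obtain ⟨g, hgs⟩ := Finset.gcd_eq_sum_mul B (id : ℤ → ℤ)
  rw [hg] at hgs
  have hb' : (b : ℤ) ≠ 0 := by exact_mod_cast hb.ne'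
  obtain ⟨l, h1, h2⟩ := list_of_coeffs B (fun a => ((r * g a) % b).toNat) B subset_rfl
  refine ⟨l, h1, ?_⟩
  have e : r = ∑ a ∈ B, a * (r * g a) := by
    calc r = r * 1 := by ring
      _ = _ := by
        rw [hgs, Finset.mul_sum]
        exact Finset.sum_congr rfl fun a _ => by simp only [id]; ring
  rw [h2]
  conv_rhs => rw [e]
  rw [Int.modEq_iff_dvd, ← Finset.sum_sub_distrib]
  refine Finset.dvd_sum fun a _ => ?_
  rw [← mul_sub]
  refine Dvd.dvd.mul_left ?_ _
  rw [Int.toNat_of_nonneg (Int.emod_nonneg _ hb')]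
  exact Int.dvd_self_sub_emod

lemma foldSum_affine (B : Finset ℤ) (s d : ℤ) (k : ℕ) :
    foldSum k (B.image fun x => s * x + d) = (foldSum k B).image fun x => s * x + k * d := by
  induction k with
  | zero => simp [foldSum]
  | succ k ih =>
    ext n
    simp only [foldSum, ih, Finset.mem_add, Finset.mem_image]
    constructor
    · rintro ⟨_, ⟨x, hx, rfl⟩, _, ⟨y, hy, rfl⟩, rfl⟩
      exact ⟨x + y, ⟨x, hx, y, hy, rfl⟩, by push_cast; ring⟩
    · rintro ⟨_, ⟨x, hx, y, hy, rfl⟩, rfl⟩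
      exact ⟨_, ⟨x, hx, rfl⟩, _, ⟨y, hy, rfl⟩, by push_cast; ring⟩

/-- Iyer–Lazarev–Miller–Zhang: for a finite set `A` of at least two integers with minimum
`a₁`, maximum `a_m`, and `s = gcd` of the differences of elements of `A` from `a₁`, there
are an integer `C` and an `N ≤ (a_m - a₁)/s` such that `|kA| = k(a_m - a₁)/s - C` for all
`k ≥ N`. -/
theorem kfold_sumset_card_eventually_linear (A : Finset ℤ) (hA : 2 ≤ A.card) :
    ∃ C : ℤ, ∃ N : ℕ,
      (N : ℤ) ≤ (A.max' (Finset.card_pos.mp (by omega)) -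
          A.min' (Finset.card_pos.mp (by omega))) /
          (A.gcd fun a => a - A.min' (Finset.card_pos.mp (by omega))) ∧
      ∀ k : ℕ, N ≤ k →
        ((foldSum k A).card : ℤ) =
          (k : ℤ) * ((A.max' (Finset.card_pos.mp (by omega)) -
            A.min' (Finset.card_pos.mp (by omega))) /
            (A.gcd fun a => a - A.min' (Finset.card_pos.mp (by omega)))) - C := by
  have hne : A.Nonempty := Finset.card_pos.mp (by omega)
  obtain ⟨lo, hlo⟩ : ∃ lo, lo = A.min' hne := ⟨_, rfl⟩
  obtain ⟨hi, hhi⟩ : ∃ hi, hi = A.max' hne := ⟨_, rfl⟩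
  rw [← hlo, ← hhi]
  obtain ⟨s, hs⟩ : ∃ s, s = A.gcd fun a => a - lo := ⟨_, rfl⟩
  rw [← hs]
  have hloA : lo ∈ A := hlo ▸ A.min'_mem hne
  have hhiA : hi ∈ A := hhi ▸ A.max'_mem hne
  have hlt : lo < hi := by
    rw [hlo, hhi]; exact Finset.min'_lt_max'_of_card A (by omega)
  have hs0 : 0 ≤ s := by rw [hs]; exact Int.finsetGcd_nonneg
  have hdvd : ∀ a ∈ A, s ∣ a - lo := fun a ha => by
    rw [hs]; exact Finset.gcd_dvd (f := fun a => a - lo) ha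
  have hspos : 0 < s := by
    rcases lt_or_eq_of_le hs0 with h | h
    · exact h
    · have := hdvd hi hhiA
      rw [← h, zero_dvd_iff] at this
      omega
  let B : Finset ℤ := A.image fun a => (a - lo) / s
  have hAB : A = B.image fun x => s * x + lo := by
    simp only [B, Finset.image_image]
    conv_lhs => rw [← Finset.image_id (s := A)]
    refine Finset.image_congr fun a ha => ?_
    simp only [Function.comp, id]
    rw [Int.mul_ediv_cancel' (hdvd a ha)]; ring
  have hg : B.gcd id = 1 := by
    rw [← Finset.gcd_eq_gcd_image, hs]
    exact Finset.gcd_div_eq_one (f := fun a => a - lo) hhiA (by omega)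
  have hbpos : 0 < (hi - lo) / s :=
    Int.ediv_pos_of_pos_of_dvd (by omega) hs0 (hdvd hi hhiA)
  obtain ⟨b, hb⟩ : ∃ b : ℕ, (b : ℤ) = (hi - lo) / s := ⟨((hi - lo) / s).toNat, by omega⟩
  rw [← hb] at hbpos ⊢
  have hb0 : 0 < b := by exact_mod_cast hbpos
  have hBb : ∀ a ∈ B, 0 ≤ a ∧ a ≤ (b : ℤ) := by
    intro x hx
    obtain ⟨a, ha, rfl⟩ := Finset.mem_image.1 hx
    have h1 : lo ≤ a := hlo ▸ A.min'_le a ha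
    have h2 : a ≤ hi := hhi ▸ A.le_max' a ha
    rw [hb]
    exact ⟨Int.ediv_nonneg (by omega) hs0, Int.ediv_le_ediv hspos (by omega)⟩
  have h0B : (0 : ℤ) ∈ B := Finset.mem_image.2 ⟨lo, hloA, by simp⟩
  have hbB : (b : ℤ) ∈ B := Finset.mem_image.2 ⟨hi, hhiA, hb.symm⟩
  have hcard : ∀ k, (foldSum k A).card = (foldSum k B).card := by
    intro k
    rw [hAB, foldSum_affine]
    refine Finset.card_image_of_injective _ fun x y hxy => ?_
    have hxy' : s * x + k * lo = s * y + k * lo := hxy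
    exact mul_left_cancel₀ hspos.ne' (by linarith)
  refine ⟨b * b - (foldSum b B).card, b, le_rfl, ?_⟩
  intro k hk
  rw [hcard]
  induction k, hk using Nat.le_induction with
  | base => ring
  | succ k hk ih =>
    rw [card_step B b hb0 hBb h0B hbB (all_classes B b hb0 hg) k hk]
    push_cast
    linarith
end

section
/- For every fixed positive integer k, a positive percentage of sets are k-generational sum-dominant: the liminf as n → ∞ of (number of subsets A ⊆ {0,1,…,n−1} such that |cA + cA| > |cA − cA| for every 1 ≤ c ≤ k) divided by 2^n is strictly positive. -/
open Finset Filter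
open scoped Pointwise Classical

lemma fs_succ (c : ℕ) (A : Finset ℤ) : foldSum (c+1) A = A + foldSum c A := rfl

lemma fs_add (c d : ℕ) (A : Finset ℤ) : foldSum (c + d) A = foldSum c A + foldSum d A := by
  induction c with
  | zero => rw [Nat.zero_add]; change _ = {0} + _; rw [Finset.singleton_add]; simp
  | succ c ih => rw [show c + 1 + d = (c + d) + 1 by ring, fs_succ, fs_succ, ih, add_assoc]

lemma fs_mono (c : ℕ) {A B : Finset ℤ} (h : A ⊆ B) : foldSum c A ⊆ foldSum c B := by
  induction c with
  | zero => simp [foldSum]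
  | succ c ih => exact Finset.add_subset_add h ih

lemma fs_T_mem (c : ℕ) (x : ℤ) :
    x ∈ foldSum c {0, 1, 3} ↔ 0 ≤ x ∧ x ≤ 3 * c ∧ x ≠ 3 * c - 1 := by
  induction c generalizing x with
  | zero => simp [foldSum]; omega
  | succ c ih =>
    rw [fs_succ, Finset.mem_add]
    constructor
    · rintro ⟨y, hy, z, hz, rfl⟩
      rw [ih] at hz
      simp at hy
      push_cast
      omega
    · intro h
      push_cast at h
      have : (0 ≤ x ∧ x ≤ 3 * c ∧ x ≠ 3 * (c:ℤ) - 1) ∨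
        (0 ≤ x - 1 ∧ x - 1 ≤ 3 * c ∧ x - 1 ≠ 3 * (c:ℤ) - 1) ∨
        (0 ≤ x - 3 ∧ x - 3 ≤ 3 * c ∧ x - 3 ≠ 3 * (c:ℤ) - 1) := by omega
      rcases this with h | h | h
      · exact ⟨0, by simp, x, (ih _).2 h, by ring⟩
      · exact ⟨1, by simp, x - 1, (ih _).2 h, by ring⟩
      · exact ⟨3, by simp, x - 3, (ih _).2 h, by ring⟩

lemma fs_T_card (c : ℕ) (hc : 1 ≤ c) : (foldSum c {0, 1, 3}).card = 3 * c := by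
  have : foldSum c {0, 1, 3} = (Finset.Icc (0:ℤ) (3 * c)).erase (3 * c - 1) := by
    ext x
    rw [fs_T_mem, Finset.mem_erase, Finset.mem_Icc]
    tauto
  rw [this, Finset.card_erase_of_mem (by rw [Finset.mem_Icc]; omega), Int.card_Icc]
  omega

lemma fs_low (A : Finset ℤ) (a : ℤ) (ha : 0 < a)
    (hA : ∀ e ∈ A, e ∈ ({0, 1, 3} : Finset ℤ) ∨ a ≤ e) (c : ℕ) (u : ℤ)
    (hu : u ∈ foldSum c A) : u ∈ foldSum c {0, 1, 3} ∨ a ≤ u := by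
  induction c generalizing u with
  | zero => left; simpa [foldSum] using hu
  | succ c ih =>
    rw [fs_succ, Finset.mem_add] at hu
    obtain ⟨y, hy, z, hz, rfl⟩ := hu
    have h0 : 0 ≤ y := by
      rcases hA y hy with h | h
      · simp at h; omega
      · omega
    have h1 : 0 ≤ z := by
      rcases ih z hz with h | h
      · exact ((fs_T_mem _ _).1 h).1
      · omega
    rcases hA y hy with h | h
    · rcases ih z hz with h' | h'
      · left; exact Finset.add_mem_add h h'
      · right; omega
    · right; omega

lemma fs_high (A : Finset ℤ) (a N : ℤ) (ha : 0 < a)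
    (hA : ∀ e ∈ A, e ≤ N - a ∨ e = N) (c : ℕ) (u : ℤ)
    (hu : u ∈ foldSum c A) : u ≤ c * N - a ∨ u = c * N := by
  induction c generalizing u with
  | zero => right; simpa [foldSum] using hu
  | succ c ih =>
    rw [fs_succ, Finset.mem_add] at hu
    obtain ⟨y, hy, z, hz, rfl⟩ := hu
    have e : ((c + 1 : ℕ) : ℤ) * N = c * N + N := by push_cast; ring
    rw [e]
    have := hA y hy
    have := ih z hz
    omega

lemma fs_fill (A : Finset ℤ) (a N : ℤ) (hN : 2 * a ≤ N) (ha : 0 < a)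
    (h0 : (0:ℤ) ∈ A) (h1 : N ∈ A) (h2 : Finset.Icc a (2 * N - a) ⊆ A + A) (c : ℕ) :
    Finset.Icc a ((c + 2 : ℕ) * N - a) ⊆ foldSum (c + 2) A := by
  induction c with
  | zero =>
    have e : A + {0} = A := by rw [Finset.add_singleton]; simp
    have : foldSum (0 + 2) A = A + A := by change A + (A + {0}) = _; rw [e]
    rw [this]; simpa using h2
  | succ c ih =>
    intro x hx
    rw [Finset.mem_Icc] at hx
    rw [show c + 1 + 2 = (c + 2) + 1 by ring, fs_succ, Finset.mem_add]
    have e : ((c + 1 + 2 : ℕ) : ℤ) * N = (c + 2 : ℕ) * N + N := by push_cast; ring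
    have e2 : ((c + 2 : ℕ) : ℤ) * N = c * N + 2 * N := by push_cast; ring
    have : 0 ≤ (c:ℤ) * N := by apply mul_nonneg <;> omega
    rw [e] at hx
    by_cases h : x ≤ (c + 2 : ℕ) * N - a
    · exact ⟨0, h0, x, ih (by rw [Finset.mem_Icc]; omega), by ring⟩
    · exact ⟨N, h1, x - N, ih (by rw [Finset.mem_Icc]; omega), by ring⟩

lemma fs_end (A : Finset ℤ) (N : ℤ) (h1 : N ∈ A) (c : ℕ) : c * N ∈ foldSum c A := by
  induction c with
  | zero => simp [foldSum]
  | succ c ih =>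
    rw [fs_succ, Finset.mem_add]
    exact ⟨N, h1, _, ih, by push_cast; ring⟩

lemma key (A : Finset ℤ) (a N : ℤ) (c : ℕ) (hc : 1 ≤ c) (hac : 6 * c < a) (hN : 2 * a ≤ N)
    (hT : ({0, 1, 3} : Finset ℤ) ⊆ A) (h1 : N ∈ A)
    (hlow : ∀ e ∈ A, e ∈ ({0, 1, 3} : Finset ℤ) ∨ a ≤ e)
    (hhigh : ∀ e ∈ A, e ≤ N - a ∨ e = N)
    (h2 : Finset.Icc a (2 * N - a) ⊆ A + A) :
    (foldSum c A - foldSum c A).card < (foldSum c A + foldSum c A).card := by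
  have ha : 0 < a := by omega
  have hcN : N ≤ c * N := by nlinarith
  have lower : (2 * (c * N) - 2 * a + 1 : ℤ) + 6 * c + 1 ≤ (foldSum c A + foldSum c A).card := by
    have hsub : insert (2 * (c * N)) (foldSum (2 * c) {0, 1, 3} ∪ Finset.Icc a (2 * (c * N) - a))
        ⊆ foldSum c A + foldSum c A := by
      rw [← fs_add, ← two_mul, Finset.insert_subset_iff, Finset.union_subset_iff]
      refine ⟨?_, fs_mono _ hT, ?_⟩
      · have := fs_end A N h1 (2 * c)
        push_cast at this
        rwa [mul_assoc] at this
      · have := fs_fill A a N hN ha (hT (by simp)) h1 h2 (2 * c - 2)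
        rw [show 2 * c - 2 + 2 = 2 * c by omega] at this
        push_cast at this
        rwa [mul_assoc] at this
    have := Finset.card_le_card hsub
    rw [Finset.card_insert_of_notMem, Finset.card_union_of_disjoint, fs_T_card _ (by omega),
      Int.card_Icc] at this
    · omega
    · rw [Finset.disjoint_left]
      intro x hx
      rw [fs_T_mem] at hx
      rw [Finset.mem_Icc]
      push_cast at hx
      omega
    · rw [Finset.mem_union, fs_T_mem, Finset.mem_Icc]
      push_cast
      omega
  have upper : ((foldSum c A - foldSum c A).card : ℤ) ≤ (2 * (c * N) - 2 * a + 1 : ℤ) + 6 * c := by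
    have hsub : foldSum c A - foldSum c A ⊆ ((foldSum c {0, 1, 3}).image (fun y => y - c * N) ∪
        (foldSum c {0, 1, 3}).image (fun y => c * N - y)) ∪
        Finset.Icc (a - c * N) (c * N - a) := by
      intro d hd
      rw [Finset.mem_sub] at hd
      obtain ⟨u, hu, v, hv, rfl⟩ := hd
      simp only [Finset.mem_union, Finset.mem_image, Finset.mem_Icc]
      have u1 := fs_low A a ha hlow c u hu
      have v1 := fs_low A a ha hlow c v hv
      have u2 := fs_high A a N ha hhigh c u hu
      have v2 := fs_high A a N ha hhigh c v hv
      have nn : ∀ w, (w ∈ foldSum c {0, 1, 3} ∨ a ≤ w) → 0 ≤ w := by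
        rintro w (h | h)
        · exact ((fs_T_mem _ _).1 h).1
        · omega
      have u3 := nn u u1
      have v3 := nn v v1
      rcases v2 with v2 | v2
      · rcases u2 with u2 | u2
        · right; omega
        · rcases v1 with v1 | v1
          · left; right; exact ⟨v, v1, by rw [u2]⟩
          · right; omega
      · rcases u1 with u1 | u1
        · left; left; exact ⟨u, u1, by rw [v2]⟩
        · right; omega
    have h3 := Finset.card_le_card hsub
    have h4 := Finset.card_union_le ((foldSum c {0, 1, 3}).image (fun y => y - c * N) ∪
        (foldSum c {0, 1, 3}).image (fun y => c * N - y)) (Finset.Icc (a - c * N) (c * N - a))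
    have h5 := Finset.card_union_le ((foldSum c {0, 1, 3}).image (fun y => y - c * N))
        ((foldSum c {0, 1, 3}).image (fun y => c * N - y))
    have h6 := Finset.card_image_le (s := foldSum c {0, 1, 3}) (f := fun y => y - c * N)
    have h7 := Finset.card_image_le (s := foldSum c {0, 1, 3}) (f := fun y => c * N - y)
    rw [fs_T_card _ hc] at h6 h7
    rw [Int.card_Icc] at h4
    omega
  omega

lemma mem_filter_inst {α : Type*} (s : Finset α) (p : α → Prop) (inst : DecidablePred p) (x : α) :
    x ∈ s.filter p ↔ x ∈ s ∧ p x := Finset.mem_filter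

lemma card_filter_inst {α : Type*} (s : Finset α) (p : α → Prop) (inst : DecidablePred p) :
    (s.filter p).card ≤ s.card := Finset.card_filter_le _ _

/-- number of subsets of `s` satisfying `p` -/
noncomputable def cnt (s : Finset ℤ) (p : Finset ℤ → Prop) : ℕ := (s.powerset.filter p).card

lemma cnt_mono (s : Finset ℤ) (p q : Finset ℤ → Prop) (h : ∀ M, p M → q M) :
    cnt s p ≤ cnt s q := by
  apply Finset.card_le_card
  intro M
  simp only [Finset.mem_filter]
  exact fun hh => ⟨hh.1, h _ hh.2⟩

lemma pw_insert {s : Finset ℤ} {b : ℤ} (hb : b ∉ s) (p : Finset ℤ → Prop) :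
    cnt (insert b s) p = cnt s p + cnt s (fun M => p (insert b M)) := by
  unfold cnt
  rw [Finset.powerset_insert, Finset.filter_union, Finset.card_union_of_disjoint]
  · congr 1
    rw [Finset.filter_image, Finset.card_image_of_injOn]
    intro M hM M' hM' h
    simp only [Finset.coe_filter, Finset.mem_powerset, Set.mem_ofPred_eq] at hM hM'
    have h1 : b ∉ M := fun h => hb (hM.1 h)
    have h2 : b ∉ M' := fun h => hb (hM'.1 h)
    replace h : insert b M = insert b M' := h
    rw [← Finset.erase_insert h1, h, Finset.erase_insert h2]
  · rw [Finset.disjoint_left]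
    intro M hM hM'
    simp only [Finset.mem_filter, Finset.mem_powerset, Finset.mem_image] at hM hM'
    obtain ⟨⟨Q, hQ, rfl⟩, -⟩ := hM'
    exact hb (hM.1 (Finset.mem_insert_self _ _))

lemma pairs_count (x : ℤ) (I : Finset ℤ) : ∀ U : Finset ℤ, (∀ i ∈ I, i ∈ U ∧ x - i ∈ U ∧ x - i ∉ I) →
    cnt U (fun M => ∀ i ∈ I, ¬ (i ∈ M ∧ x - i ∈ M)) * 4 ^ I.card
      ≤ 3 ^ I.card * 2 ^ U.card := by
  induction I using Finset.induction_on with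
  | empty => intro U _; simp [cnt]
  | insert i I hi ih =>
    intro U hU
    obtain ⟨hiU, hxU, hxI⟩ := hU i (Finset.mem_insert_self _ _)
    have hne : x - i ≠ i := fun h => hxI (by rw [h]; exact Finset.mem_insert_self _ _)
    set V := (U.erase i).erase (x - i) with hV
    have hxV : x - i ∉ V := Finset.notMem_erase _ _
    have hxe : x - i ∈ U.erase i := Finset.mem_erase.2 ⟨hne, hxU⟩
    have hiV : i ∉ insert (x - i) V := by
      rw [hV, Finset.insert_erase hxe]; exact Finset.notMem_erase _ _
    have hUV : U = insert i (insert (x - i) V) := by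
      rw [hV, Finset.insert_erase hxe, Finset.insert_erase hiU]
    have hIV := ih V (by
      intro j hj
      obtain ⟨h1, h2, h3⟩ := hU j (Finset.mem_insert_of_mem hj)
      simp only [Finset.mem_insert, not_or] at h3 hxI
      have hji : j ≠ i := fun h => hi (h ▸ hj)
      have hjx : j ≠ x - i := fun h => hxI.2 (h ▸ hj)
      refine ⟨?_, ?_, h3.2⟩
      · simp [hV, hji, hjx, h1]
      · simp only [hV, Finset.mem_erase]
        refine ⟨fun h => hji (by omega), h3.1, h2⟩)
    have hcU : U.card = V.card + 2 := by
      rw [hUV, Finset.card_insert_of_notMem hiV, Finset.card_insert_of_notMem hxV]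
    set f := cnt V (fun M => ∀ i ∈ I, ¬ (i ∈ M ∧ x - i ∈ M)) with hf
    have main : cnt U
        (fun M => ∀ j ∈ insert i I, ¬ (j ∈ M ∧ x - j ∈ M)) ≤ 3 * f := by
      rw [hUV, pw_insert hiV, pw_insert hxV, pw_insert hxV]
      have g : ∀ W : Finset ℤ → Finset ℤ, (∀ M, M ⊆ W M) →
          cnt V (fun M => ∀ j ∈ insert i I, ¬ (j ∈ W M ∧ x - j ∈ W M)) ≤ f := by
        intro W hW
        apply cnt_mono
        intro M h2
        exact fun j hj hh => h2 j (Finset.mem_insert_of_mem hj) ⟨hW _ hh.1, hW _ hh.2⟩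
      have g1 := g (fun M => M) (fun M => subset_rfl)
      have g2 := g (fun M => insert i M) (fun M => Finset.subset_insert _ _)
      have g3 := g (fun M => insert (x - i) M) (fun M => Finset.subset_insert _ _)
      have g4 : cnt V (fun M => ∀ j ∈ insert i I,
          ¬ (j ∈ insert i (insert (x - i) M) ∧ x - j ∈ insert i (insert (x - i) M))) = 0 := by
        unfold cnt
        rw [Finset.card_eq_zero, Finset.eq_empty_iff_forall_notMem]
        intro M h
        rw [mem_filter_inst] at h
        exact h.2 i (Finset.mem_insert_self _ _) (by simp)
      omega
    rw [Finset.card_insert_of_notMem hi, hcU]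
    calc _ ≤ 3 * f * 4 ^ (I.card + 1) := Nat.mul_le_mul_right _ main
      _ = 12 * (f * 4 ^ I.card) := by ring
      _ ≤ 12 * (3 ^ I.card * 2 ^ V.card) := Nat.mul_le_mul_left _ hIV
      _ = _ := by ring

/-- bad event bound -/
lemma bad_count (x : ℤ) (I U : Finset ℤ) (t : ℕ) (hI : ∀ i ∈ I, i ∈ U ∧ x - i ∈ U ∧ x - i ∉ I)
    (ht : t ≤ 2 * I.card) :
    ((U.powerset.filter (fun M => x ∉ M + M)).card : ℝ) ≤ (7/8 : ℝ) ^ t * 2 ^ U.card := by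
  have h := pairs_count x I U hI
  have h0 : (U.powerset.filter (fun M => x ∉ M + M)).card ≤
      cnt U (fun M => ∀ i ∈ I, ¬ (i ∈ M ∧ x - i ∈ M)) := by
    unfold cnt
    apply Finset.card_le_card
    intro M
    simp only [Finset.mem_filter]
    rintro ⟨h1, h2⟩
    exact ⟨h1, fun j hj hh => h2 (Finset.mem_add.2 ⟨j, hh.1, x - j, hh.2, by ring⟩)⟩
  have h1 : ((U.powerset.filter (fun M => x ∉ M + M)).card : ℝ) * 4 ^ I.card
      ≤ 3 ^ I.card * 2 ^ U.card := by
    exact_mod_cast (Nat.mul_le_mul_right _ h0).trans h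
  have h2 : ((U.powerset.filter (fun M => x ∉ M + M)).card : ℝ) ≤ (3/4 : ℝ) ^ I.card * 2 ^ U.card := by
    rw [div_pow, div_mul_eq_mul_div, le_div_iff₀ (by positivity)]
    exact h1
  refine h2.trans (mul_le_mul_of_nonneg_right ?_ (by positivity))
  calc (3/4 : ℝ) ^ I.card ≤ ((7/8 : ℝ)^2) ^ I.card := by
        apply pow_le_pow_left₀ <;> norm_num
    _ = (7/8 : ℝ) ^ (2 * I.card) := by rw [pow_mul]
    _ ≤ _ := pow_le_pow_of_le_one (by norm_num) (by norm_num) ht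

lemma good_count (a l N : ℤ) (ha : 0 < a) (hl : a + 15 ≤ l) (hN : 2 * l ≤ N) :
    (2:ℝ) ^ (Finset.Icc a (N - a)).card / 2 ≤
      (((Finset.Icc a (N - a)).powerset.filter
        (fun M => ∀ x, 2 * l - 1 ≤ x → x ≤ 2 * N - 2 * l + 1 → x ∈ M + M)).card : ℝ) := by
  set U := Finset.Icc a (N - a) with hU
  set G := U.powerset.filter
        (fun M => ∀ x, 2 * l - 1 ≤ x → x ≤ 2 * N - 2 * l + 1 → x ∈ M + M) with hG
  set m := (N - (2 * l - 1) + 1).toNat with hm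
  let B : ℤ → Finset (Finset ℤ) := fun x => U.powerset.filter (fun M => x ∉ M + M)
  have cover : U.powerset ⊆ G ∪ (Finset.range m).biUnion
      (fun y => B (2 * l - 1 + y) ∪ B (2 * N - (2 * l - 1 + y))) := by
    intro M hM
    by_cases hMG : M ∈ G
    · exact Finset.mem_union_left _ hMG
    · apply Finset.mem_union_right
      simp only [hG, Finset.mem_filter, not_and, not_forall] at hMG
      obtain ⟨x, h1, h2, h3⟩ := hMG hM
      rw [Finset.mem_biUnion]
      by_cases hx : x ≤ N
      · refine ⟨(x - (2 * l - 1)).toNat, ?_, ?_⟩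
        · rw [Finset.mem_range]; omega
        · apply Finset.mem_union_left
          rw [show 2 * l - 1 + ((x - (2 * l - 1)).toNat : ℤ) = x by omega]
          exact Finset.mem_filter.2 ⟨hM, h3⟩
      · refine ⟨(2 * N - x - (2 * l - 1)).toNat, ?_, ?_⟩
        · rw [Finset.mem_range]; omega
        · apply Finset.mem_union_right
          rw [show 2 * N - (2 * l - 1 + ((2 * N - x - (2 * l - 1)).toNat : ℤ)) = x by omega]
          exact Finset.mem_filter.2 ⟨hM, h3⟩
  have hB : ∀ y ∈ Finset.range m, ((B (2 * l - 1 + y) ∪ B (2 * N - (2 * l - 1 + y))).card : ℝ)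
      ≤ 2 * ((7/8 : ℝ) ^ 28 * 2 ^ U.card) * (7/8) ^ y := by
    intro y hy
    rw [Finset.mem_range] at hy
    have b1 := bad_count (2 * l - 1 + y) (Finset.Ico a ((2 * l - 1 + y + 1) / 2)) U (28 + y)
      (by intro i; simp only [hU, Finset.mem_Ico, Finset.mem_Icc]; omega)
      (by rw [Int.card_Ico]; omega)
    have b2 := bad_count (2 * N - (2 * l - 1 + y))
      (Finset.Ioc (N - ((2 * l - 1 + y + 1) / 2)) (N - a)) U (28 + y)
      (by intro i; simp only [hU, Finset.mem_Ioc, Finset.mem_Icc]; omega)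
      (by rw [Int.card_Ioc]; omega)
    have := Finset.card_union_le (B (2 * l - 1 + y)) (B (2 * N - (2 * l - 1 + y)))
    have h' : ((B (2 * l - 1 + y) ∪ B (2 * N - (2 * l - 1 + y))).card : ℝ) ≤
      (B (2 * l - 1 + y)).card + (B (2 * N - (2 * l - 1 + y))).card := by exact_mod_cast this
    have e : (7/8 : ℝ) ^ (28 + y) = (7/8) ^ 28 * (7/8) ^ y := pow_add _ _ _
    rw [e] at b1 b2
    calc _ ≤ _ := h'
      _ ≤ _ := add_le_add b1 b2
      _ = _ := by ring
  have hgeo : ∑ y ∈ Finset.range m, (7/8 : ℝ) ^ y ≤ 8 := by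
    rw [geom_sum_eq (by norm_num)]
    have : (0:ℝ) ≤ (7/8) ^ m := by positivity
    rw [div_le_iff_of_neg (by norm_num)]
    linarith
  have hsum : (((Finset.range m).biUnion
      (fun y => B (2 * l - 1 + y) ∪ B (2 * N - (2 * l - 1 + y)))).card : ℝ) ≤ 2 ^ U.card / 2 := by
    calc _ ≤ ∑ y ∈ Finset.range m,
          ((B (2 * l - 1 + y) ∪ B (2 * N - (2 * l - 1 + y))).card : ℝ) := by
          exact_mod_cast Finset.card_biUnion_le
      _ ≤ ∑ y ∈ Finset.range m, 2 * ((7/8 : ℝ) ^ 28 * 2 ^ U.card) * (7/8) ^ y :=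
          Finset.sum_le_sum hB
      _ = 2 * ((7/8 : ℝ) ^ 28 * 2 ^ U.card) * ∑ y ∈ Finset.range m, (7/8 : ℝ) ^ y := by
          rw [Finset.mul_sum]
      _ ≤ 2 * ((7/8 : ℝ) ^ 28 * 2 ^ U.card) * 8 := by gcongr
      _ = (16 * (7/8 : ℝ) ^ 28) * 2 ^ U.card := by ring
      _ ≤ (1/2) * 2 ^ U.card := by gcongr; norm_num
      _ = _ := by ring
  have htot := (Finset.card_le_card cover).trans (Finset.card_union_le _ _)
  rw [Finset.card_powerset] at htot
  have htot' : (2:ℝ) ^ U.card ≤ G.card + ((Finset.range m).biUnion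
      (fun y => B (2 * l - 1 + y) ∪ B (2 * N - (2 * l - 1 + y)))).card := by exact_mod_cast htot
  linarith

lemma half_split (x p q : ℤ) (h1 : 2 * p ≤ x) (h2 : x ≤ 2 * q) (S : Finset ℤ)
    (hS : ∀ e, p ≤ e → e ≤ q → e ∈ S) : x ∈ S + S :=
  Finset.mem_add.2 ⟨x / 2, hS _ (by omega) (by omega), x - x / 2, hS _ (by omega) (by omega),
    by ring⟩

/-- Iyer–Lazarev–Miller–Zhang: for every fixed `k ≥ 1`, a positive percentage of subsets
`A` of `{0,…,n-1}` are `k`-generational sum-dominant, i.e. `|cA + cA| > |cA - cA|` for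
every `1 ≤ c ≤ k`. -/
theorem positive_percentage_k_generational (k : ℕ) (hk : 1 ≤ k) :
    0 < Filter.liminf
      (fun n : ℕ =>
        ((((Finset.Icc (0 : ℤ) ((n : ℤ) - 1)).powerset.filter fun A =>
          ∀ c, 1 ≤ c → c ≤ k →
            (foldSum c A - foldSum c A).card < (foldSum c A + foldSum c A).card).card
              : ℝ) / 2 ^ n))
      Filter.atTop := by
  obtain ⟨a, ha⟩ : ∃ a : ℕ, a = 6 * k + 1 := ⟨_, rfl⟩
  obtain ⟨l, hl⟩ : ∃ l : ℕ, l = 2 * a + 15 := ⟨_, rfl⟩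
  have hδ : (0:ℝ) < 1 / 2 ^ (2 * l + 1) := by positivity
  refine lt_of_lt_of_le hδ ?_
  refine le_liminf_of_le ?_ ?_
  · refine Filter.IsBoundedUnder.isCoboundedUnder_ge ⟨1, ?_⟩
    rw [Filter.eventually_map]
    refine Filter.Eventually.of_forall fun n => ?_
    change _ / _ ≤ (1:ℝ)
    rw [div_le_one (by positivity)]
    have h0 : (Finset.Icc (0 : ℤ) ((n : ℤ) - 1)).powerset.card = 2 ^ n := by
      rw [Finset.card_powerset, Int.card_Icc, show ((n:ℤ) - 1 + 1 - 0).toNat = n by omega]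
    have h1 := (card_filter_inst (Finset.Icc (0 : ℤ) ((n : ℤ) - 1)).powerset (fun A =>
          ∀ c, 1 ≤ c → c ≤ k →
            (foldSum c A - foldSum c A).card < (foldSum c A + foldSum c A).card)
          (fun _ => Classical.propDecidable _)).trans_eq h0
    exact_mod_cast h1
  · filter_upwards [Filter.eventually_ge_atTop (2 * l + 1)] with n hn
    obtain ⟨N, hNn⟩ : ∃ N : ℤ, N = (n:ℤ) - 1 := ⟨_, rfl⟩
    rw [← hNn]
    set F := ((Finset.Icc (0 : ℤ) N).powerset.filter fun A =>
          ∀ c, 1 ≤ c → c ≤ k →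
            (foldSum c A - foldSum c A).card < (foldSum c A + foldSum c A).card) with hF
    have hgood := good_count a l N (by omega) (by omega) (by omega)
    set U := Finset.Icc (a:ℤ) (N - a) with hU
    set G := U.powerset.filter
        (fun M => ∀ x, 2 * (l:ℤ) - 1 ≤ x → x ≤ 2 * N - 2 * l + 1 → x ∈ M + M) with hG
    let E : Finset ℤ := Finset.Ico (a:ℤ) l ∪ Finset.Ioc (N - l) (N - a)
    let φ : Finset ℤ → Finset ℤ := fun M => insert N ({0, 1, 3} ∪ E ∪ M)
    have hφ : ∀ M e, e ∈ φ M ↔ (e = N ∨ (((e = 0 ∨ e = 1 ∨ e = 3) ∨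
        ((a ≤ e ∧ e < l) ∨ (N - l < e ∧ e ≤ N - a))) ∨ e ∈ M)) := by
      intro M e
      simp only [φ, E, Finset.mem_insert, Finset.mem_union, Finset.mem_Ico, Finset.mem_Ioc,
        Finset.mem_singleton]
    have hmaps : ∀ M ∈ G, φ M ∈ F := by
      intro M hM
      rw [hG, Finset.mem_filter, Finset.mem_powerset] at hM
      obtain ⟨hMU, hMs⟩ := hM
      have hMU' : ∀ e ∈ M, a ≤ e ∧ e ≤ N - a := fun e he => Finset.mem_Icc.1 (hMU he)
      have hMφ : M ⊆ φ M := fun e he => (hφ M e).2 (Or.inr (Or.inr he))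
      rw [hF, mem_filter_inst, Finset.mem_powerset]
      refine ⟨?_, ?_⟩
      · intro e he
        rw [hφ] at he
        rw [Finset.mem_Icc]
        have := hMU' e
        by_cases h : e ∈ M
        · have := this h; omega
        · simp only [h, or_false] at he; omega
      · intro c hc hck
        refine key (φ M) a N c hc (by omega) (by omega) ?_ ?_ ?_ ?_ ?_
        · intro e he
          rw [hφ]
          simp at he
          tauto
        · rw [hφ]; left; rfl
        · intro e he
          rw [hφ] at he
          have := hMU' e
          simp only [Finset.mem_insert, Finset.mem_singleton]
          by_cases h : e ∈ M
          · have := this h; omega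
          · simp only [h, or_false] at he; omega
        · intro e he
          rw [hφ] at he
          have := hMU' e
          by_cases h : e ∈ M
          · have := this h; omega
          · simp only [h, or_false] at he; omega
        · intro x hx
          rw [Finset.mem_Icc] at hx
          by_cases x1 : x < l
          · exact Finset.mem_add.2 ⟨0, (hφ _ _).2 (by omega), x, (hφ _ _).2 (by omega), by ring⟩
          by_cases x2 : x ≤ 2 * l - 2
          · exact half_split x a (l - 1) (by omega) (by omega) _
              (fun e _ _ => (hφ _ _).2 (by omega))
          by_cases x3 : x ≤ 2 * N - 2 * l + 1
          · exact Finset.add_subset_add hMφ hMφ (hMs x (by omega) x3)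
          by_cases x4 : x ≤ 2 * N - 2 * a
          · exact half_split x (N - l + 1) (N - a) (by omega) (by omega) _
              (fun e _ _ => (hφ _ _).2 (by omega))
          · exact Finset.mem_add.2 ⟨N, (hφ _ _).2 (by omega), x - N, (hφ _ _).2 (by omega), by ring⟩
    have hcard : G.card ≤ F.card * 2 ^ E.card := by
      rw [← Finset.card_powerset, ← Finset.card_product]
      apply Finset.card_le_card_of_injOn (fun M => (φ M, M ∩ E))
      · intro M hM
        simp only [Finset.coe_product, Set.mem_prod, Finset.mem_coe, Finset.mem_powerset]
        exact ⟨hmaps M hM, Finset.inter_subset_right⟩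
      · intro M hM M' hM' h
        simp only [Prod.mk.injEq] at h
        obtain ⟨h1, h2⟩ := h
        have aux : ∀ M ∈ G, ∀ e, e ∈ M ↔ (e ∈ M ∩ E ∨ (e ∈ φ M ∧ l ≤ e ∧ e ≤ N - l)) := by
          intro M hM e
          rw [hG, Finset.mem_filter, Finset.mem_powerset] at hM
          have := fun he : e ∈ M => Finset.mem_Icc.1 (hM.1 he)
          rw [hφ]
          simp only [E, Finset.mem_inter, Finset.mem_union, Finset.mem_Ico, Finset.mem_Ioc]
          by_cases h : e ∈ M
          · have := this h
            simp only [h, true_and, or_true, true_iff]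
            omega
          · simp only [h, false_and, false_or, or_false, false_iff]
            omega
        ext e
        rw [aux M hM, aux M' hM', h1, h2]
    have hE : E.card ≤ 2 * (l - a) := by
      refine (Finset.card_union_le _ _).trans ?_
      rw [Int.card_Ico, Int.card_Ioc]
      omega
    have hUc : U.card = n - 2 * a := by
      rw [hU, Int.card_Icc]; omega
    have h1 : (G.card : ℝ) ≤ F.card * 2 ^ (2 * (l - a)) := by
      exact_mod_cast hcard.trans (Nat.mul_le_mul_left _ (Nat.pow_le_pow_right (by norm_num) hE))
    rw [hUc] at hgood
    rw [div_le_div_iff₀ (by positivity) (by positivity)]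
    have e1 : (2:ℝ) ^ n = 2 ^ (n - 2 * a) * 2 ^ (2 * a) := by
      rw [← pow_add]; congr 1; omega
    have e2 : (2:ℝ) ^ (2 * l + 1) = 2 ^ (2 * (l - a)) * 2 ^ (2 * a) * 2 := by
      rw [← pow_add, ← pow_succ]; congr 1; omega
    rw [e1, e2]
    have h3 : (2:ℝ) ^ (n - 2 * a) ≤ 2 * (F.card * 2 ^ (2 * (l - a))) := by linarith
    calc _ = (2:ℝ) ^ (n - 2 * a) * 2 ^ (2 * a) := by ring
      _ ≤ 2 * (F.card * 2 ^ (2 * (l - a))) * 2 ^ (2 * a) := by gcongr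
      _ = _ := by ring
end
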